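/- arXiv:1205.3957 — 2 statements merged into one kernel-verified Lean document; each statement's English description precedes it below -/
import Mathlib

section
/- Let α, β > −1/2 and t > 0. Then for all θ, φ ∈ (0,π), the series Σ_{n=0}^∞ e^{−t(n+(α+β+1)/2)} 𝒫_n^{(α,β)}(θ) 𝒫_n^{(α,β)}(φ) converges and equals (Γ(α+β+2)/(Γ(α+1)Γ(β+1))) ∫_{−1}^{1} ∫_{−1}^{1} e^{−t(α+β+1)/2}(1−e^{−t}) / ((1−e^{−t/2})² + 2 e^{−t/2}(1−z(u,v,θ,φ)))^{α+β+2} dΠ_α(u) dΠ_β(v), where z(u,v,θ,φ) = u sin(θ/2) sin(φ/2) + v cos(θ/2) cos(φ/2). -/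
open MeasureTheory Real Set

/-- The measure `Π_γ` on `[-1,1]`: for `γ > -1/2` it has density
`Γ(γ+1)/(√π Γ(γ+1/2)) (1-u²)^{γ-1/2}`; for `γ = -1/2` it is `(δ_{-1}+δ_1)/2`. -/
noncomputable def jacobiPiMeasure (γ : ℝ) : Measure ℝ :=
  if γ = -(1/2) then (2 : ENNReal)⁻¹ • (Measure.dirac (-1) + Measure.dirac 1)
  else (volume.restrict (Icc (-1 : ℝ) 1)).withDensity
    (fun u => ENNReal.ofReal (Real.Gamma (γ + 1) / (Real.sqrt π * Real.Gamma (γ + 1/2)) *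
      (1 - u ^ 2) ^ (γ - 1/2)))

/-- The Jacobi polynomial `P_n^{(α,β)}` via the Rodrigues formula
`P_n^{(α,β)}(x) = (1-x)^{-α}(1+x)^{-β} ((-1)^n/(2^n n!)) (d/dx)^n [(1-x)^{n+α}(1+x)^{n+β}]`. -/
noncomputable def jacobiP (α β : ℝ) (n : ℕ) (x : ℝ) : ℝ :=
  (1 - x) ^ (-α) * (1 + x) ^ (-β) * ((-1:ℝ)^n / (2^n * (Nat.factorial n))) *
    iteratedDeriv n (fun y : ℝ => (1 - y) ^ ((n:ℝ) + α) * (1 + y) ^ ((n:ℝ) + β)) x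

/-- The normalized Jacobi trigonometric polynomial `𝒫_n^{(α,β)}(θ) = d_n^{α,β} P_n^{(α,β)}(cos θ)`,
with `d_n^{α,β} = ((2n+α+β+1) Γ(n+1) Γ(n+α+β+1)/(Γ(n+α+1) Γ(n+β+1)))^{1/2}`. -/
noncomputable def jacobiTrig (α β : ℝ) (n : ℕ) (θ : ℝ) : ℝ :=
  Real.sqrt ((2*n + α + β + 1) * Real.Gamma (n + 1) * Real.Gamma (n + α + β + 1) /
      (Real.Gamma (n + α + 1) * Real.Gamma (n + β + 1))) * jacobiP α β n (Real.cos θ)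

namespace JP

open Polynomial in
/-- the Jacobi differential operator in the variable `X = (1-x)/2`. -/
noncomputable def jL (α β : ℝ) (p : ℝ[X]) : ℝ[X] :=
  X * (1 - X) * derivative (derivative p) + (C (α + 1) - C (α + β + 2) * X) * derivative p

lemma jL_add (α β : ℝ) (p q : Polynomial ℝ) : jL α β (p + q) = jL α β p + jL α β q := by
  simp only [jL, Polynomial.derivative_add]; ring

lemma jL_smul (α β c : ℝ) (p : Polynomial ℝ) : jL α β (Polynomial.C c * p) = Polynomial.C c * jL α β p := by
  simp only [jL, Polynomial.derivative_C_mul]; ring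

lemma jL_sum {ι : Type*} (α β : ℝ) (s : Finset ι) (f : ι → Polynomial ℝ) :
    jL α β (∑ i ∈ s, f i) = ∑ i ∈ s, jL α β (f i) := by
  simp only [jL, Polynomial.derivative_sum, Finset.mul_sum, Finset.sum_add_distrib]

open Polynomial in
lemma jL_unique (α β : ℝ) (hα : -1 < α) (e : ℝ) (p : ℝ[X]) (h : jL α β p = C e * p)
    (h0 : p.coeff 0 = 0) : p = 0 := by
  have key : ∀ k, p.coeff k = 0 := by
    intro k
    induction k with
    | zero => exact h0
    | succ k ih =>
      have h1 := congrArg (fun q => q.coeff k) h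
      have e1 : jL α β p = X * derivative (derivative p) - X ^ 2 * derivative (derivative p)
        + C (α + 1) * derivative p - C (α + β + 2) * (X * derivative p) := by
        simp only [jL]; ring
      simp only [e1, coeff_add, coeff_sub, coeff_C_mul, ih, mul_zero] at h1
      rcases k with _ | _ | k
      · simp [coeff_derivative] at h1
        rcases h1 with h1 | h1
        · linarith
        · simpa using h1
      · simp [coeff_X_pow_mul', coeff_X_mul, coeff_derivative] at h1 ih
        rw [ih] at h1
        have : (2 * (2 + α)) * p.coeff 2 = 0 := by linarith
        rcases mul_eq_zero.1 this with h2 | h2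
        · linarith
        · simpa using h2
      · simp [coeff_X_pow_mul', coeff_X_mul, coeff_derivative] at h1 ih
        rw [ih] at h1
        have hk : (0:ℝ) ≤ k := k.cast_nonneg
        have : (((k:ℝ) + 3) * (k + 3 + α)) * p.coeff (k + 1 + 1 + 1) = 0 := by linarith
        rcases mul_eq_zero.1 this with h2 | h2
        · rcases mul_eq_zero.1 h2 with h3 | h3 <;> linarith
        · simpa using h2
  ext k; simpa using key k

open Polynomial in
lemma jL_unique' (α β : ℝ) (hα : -1 < α) (e : ℝ) (p q : ℝ[X]) (hp : jL α β p = C e * p)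
    (hq : jL α β q = C e * q) (x : ℝ) : p.eval x * q.eval 0 = p.eval 0 * q.eval x := by
  have h : C (q.eval 0) * p + C (- p.eval 0) * q = 0 := by
    apply jL_unique α β hα e
    · rw [jL_add, jL_smul, jL_smul, hp, hq]; ring
    · simp [coeff_zero_eq_eval_zero]; ring
  have := congrArg (eval x) h
  simp at this; linarith

open Polynomial in
lemma jL_mono (α β : ℝ) (i j : ℕ) :
    jL α β (X ^ i * (1 - X) ^ j) = C ((i:ℝ) * (i + α)) * (X ^ (i - 1) * (1 - X) ^ j)
      + C ((j:ℝ) * (j + β)) * (X ^ i * (1 - X) ^ (j - 1))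
      - C (((i:ℝ) + j) * (i + j + α + β + 1)) * (X ^ i * (1 - X) ^ j) := by
  have hC2 : (C (2:ℝ)) = 2 := rfl
  rcases i with _ | _ | i <;> rcases j with _ | _ | j <;>
    simp [jL, derivative_pow, derivative_mul, hC2] <;> (try ring)


/-- rising factorial -/
noncomputable def poch (x : ℝ) (n : ℕ) : ℝ := ∏ i ∈ Finset.range n, (x + i)

/-- falling factorial -/
noncomputable def fall (x : ℝ) (n : ℕ) : ℝ := ∏ i ∈ Finset.range n, (x - i)

lemma poch_succ (x : ℝ) (n : ℕ) : poch x (n + 1) = poch x n * (x + n) := Finset.prod_range_succ _ _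

lemma fall_succ (x : ℝ) (n : ℕ) : fall x (n + 1) = fall x n * (x - n) := Finset.prod_range_succ _ _

@[simp] lemma poch_zero (x : ℝ) : poch x 0 = 1 := by simp [poch]

@[simp] lemma fall_zero (x : ℝ) : fall x 0 = 1 := by simp [fall]

lemma poch_pos {x : ℝ} (hx : 0 < x) (n : ℕ) : 0 < poch x n :=
  Finset.prod_pos fun _ _ => by positivity

lemma poch_Gamma {x : ℝ} (hx : 0 < x) (n : ℕ) : Real.Gamma (x + n) = poch x n * Real.Gamma x := by
  induction n with
  | zero => simp
  | succ n ih =>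
    rw [poch_succ, Nat.cast_succ, ← add_assoc, Real.Gamma_add_one (by positivity), ih]; ring

lemma fall_eq_poch (a : ℝ) (n : ℕ) : fall (n + a) n = poch (a + 1) n := by
  unfold fall poch
  rw [← Finset.prod_range_reflect]
  refine Finset.prod_congr rfl fun i hi => ?_
  have hi := Finset.mem_range.1 hi
  have : ((n - 1 - i : ℕ) : ℝ) = n - 1 - i := by
    rw [Nat.sub_sub, Nat.cast_sub (by omega)]; push_cast; ring
  rw [this]; ring

/-- weights -/
noncomputable def wt (α β : ℝ) (i j : ℕ) : ℝ :=
  1 / (i.factorial * j.factorial * poch (α + 1) i * poch (β + 1) j)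

lemma wt_succ_left {α β : ℝ} (hα : -1 < α) (i j : ℕ) :
    wt α β (i + 1) j * ((i + 1) * (i + 1 + α)) = wt α β i j := by
  have h1 : ((i:ℝ) + 1) ≠ 0 := by positivity
  have h2 : (α + 1 + i) ≠ 0 := by
    have : (0:ℝ) ≤ i := i.cast_nonneg
    linarith
  have h3 := (poch_pos (show 0 < α + 1 by linarith) i).ne'
  unfold wt
  rw [poch_succ, Nat.factorial_succ]
  push_cast
  rw [show (i:ℝ) + 1 + α = α + 1 + i by ring]
  by_cases h : poch (β + 1) j = 0
  · simp [h]
  field_simp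

lemma wt_symm (α β : ℝ) (i j : ℕ) : wt α β i j = wt β α j i := by
  unfold wt; ring

lemma wt_succ_right {α β : ℝ} (hβ : -1 < β) (i j : ℕ) :
    wt α β i (j + 1) * ((j + 1) * (j + 1 + β)) = wt α β i j := by
  rw [wt_symm, wt_succ_left hβ, wt_symm]

open Polynomial in
noncomputable def eP (α β y : ℝ) (k : ℕ) : ℝ[X] :=
  ∑ p ∈ Finset.HasAntidiagonal.antidiagonal k, C (wt α β p.1 p.2 * (y ^ p.1 * (1 - y) ^ p.2)) * (X ^ p.1 * (1 - X) ^ p.2)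

open Polynomial in
lemma jL_eP_succ {α β : ℝ} (hα : -1 < α) (hβ : -1 < β) (y : ℝ) (k : ℕ) :
    jL α β (eP α β y (k + 1)) = eP α β y k - C (((k:ℝ) + 1) * (k + 1 + α + β + 1)) * eP α β y (k + 1) := by
  have h1 : ∑ p ∈ Finset.HasAntidiagonal.antidiagonal (k + 1), C (wt α β p.1 p.2 * (y ^ p.1 * (1 - y) ^ p.2)) *
      (C ((p.1:ℝ) * (p.1 + α)) * (X ^ (p.1 - 1) * (1 - X) ^ p.2)) = C y * eP α β y k := by
    rw [Finset.Nat.sum_antidiagonal_succ, eP, Finset.mul_sum]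
    simp only [Nat.cast_zero, zero_mul, map_zero, mul_zero, zero_add]
    refine Finset.sum_congr rfl fun p _ => ?_
    rw [← wt_succ_left hα p.1 p.2]
    simp only [Nat.add_sub_cancel, Nat.cast_add, Nat.cast_one, map_mul, map_add, map_pow, map_sub]
    ring
  have h2 : ∑ p ∈ Finset.HasAntidiagonal.antidiagonal (k + 1), C (wt α β p.1 p.2 * (y ^ p.1 * (1 - y) ^ p.2)) *
      (C ((p.2:ℝ) * (p.2 + β)) * (X ^ p.1 * (1 - X) ^ (p.2 - 1))) = C (1 - y) * eP α β y k := by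
    rw [Finset.Nat.sum_antidiagonal_succ', eP, Finset.mul_sum]
    simp only [Nat.cast_zero, zero_mul, map_zero, mul_zero, zero_add]
    refine Finset.sum_congr rfl fun p _ => ?_
    rw [← wt_succ_right hβ p.1 p.2]
    simp only [Nat.add_sub_cancel, Nat.cast_add, Nat.cast_one, map_mul, map_add, map_pow, map_sub]
    ring
  have h3 : ∑ p ∈ Finset.HasAntidiagonal.antidiagonal (k + 1), C (wt α β p.1 p.2 * (y ^ p.1 * (1 - y) ^ p.2)) *
      (C (((p.1:ℝ) + p.2) * (p.1 + p.2 + α + β + 1)) * (X ^ p.1 * (1 - X) ^ p.2))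
      = C (((k:ℝ) + 1) * (k + 1 + α + β + 1)) * eP α β y (k + 1) := by
    rw [eP, Finset.mul_sum]
    refine Finset.sum_congr rfl fun p hp => ?_
    have : (p.1:ℝ) + p.2 = k + 1 := by exact_mod_cast Finset.HasAntidiagonal.mem_antidiagonal.1 hp
    rw [this]; ring
  conv_lhs => rw [eP]
  rw [jL_sum]
  simp only [jL_smul, jL_mono, mul_sub, mul_add, Finset.sum_sub_distrib, Finset.sum_add_distrib]
  simp only [mul_add] at h1 h2 h3
  rw [h1, h2, h3]
  simp only [map_sub, map_one, mul_add]; ring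

open Polynomial in
lemma jL_eP_zero (α β y : ℝ) : jL α β (eP α β y 0) = 0 := by
  simp [eP, jL, ← C_1, -map_one]

open Polynomial in
lemma jL_S {α β : ℝ} (hα : -1 < α) (hβ : -1 < β) (y : ℝ) (n : ℕ) (d : ℕ → ℝ)
    (hd : ∀ k < n, d (k + 1) = (k * (k + α + β + 1) - n * (n + α + β + 1)) * d k) :
    jL α β (∑ k ∈ Finset.range (n + 1), C (d k) * eP α β y k)
     = C (- (n * (n + α + β + 1))) * ∑ k ∈ Finset.range (n + 1), C (d k) * eP α β y k := by
  have key : ∀ m ≤ n, jL α β (∑ k ∈ Finset.range (m + 1), C (d k) * eP α β y k)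
     = C (- (n * (n + α + β + 1))) * ∑ k ∈ Finset.range (m + 1), C (d k) * eP α β y k
      - C ((m * (m + α + β + 1) - n * (n + α + β + 1)) * d m) * eP α β y m := by
    intro m
    induction m with
    | zero => intro _; simp [jL_smul, jL_eP_zero]; ring
    | succ m ih =>
      intro hm
      rw [Finset.sum_range_succ, jL_add, ih (by omega), jL_smul, jL_eP_succ hα hβ, hd m (by omega)]
      simp only [map_mul, map_sub, map_add, map_neg, Nat.cast_add, Nat.cast_one]
      ring
  rw [key n le_rfl]; simp

/-- coefficients of Jacobi polynomial -/
noncomputable def qc (α β : ℝ) (n i j : ℕ) : ℝ :=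
  (-1) ^ i * fall (n + α) j * fall (n + β) i / (i.factorial * j.factorial)

open Polynomial in
noncomputable def Qp (α β : ℝ) (n : ℕ) : ℝ[X] :=
  ∑ p ∈ Finset.HasAntidiagonal.antidiagonal n, C (qc α β n p.1 p.2) * (X ^ p.1 * (1 - X) ^ p.2)

open Polynomial in
lemma jL_Qp (α β : ℝ) (n : ℕ) :
    jL α β (Qp α β n) = C (- (n * (n + α + β + 1))) * Qp α β n := by
  have h3 : ∑ p ∈ Finset.HasAntidiagonal.antidiagonal n, C (qc α β n p.1 p.2) *
      (C (((p.1:ℝ) + p.2) * (p.1 + p.2 + α + β + 1)) * (X ^ p.1 * (1 - X) ^ p.2))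
      = C ((n:ℝ) * (n + α + β + 1)) * Qp α β n := by
    rw [Qp, Finset.mul_sum]
    refine Finset.sum_congr rfl fun p hp => ?_
    have : (p.1:ℝ) + p.2 = n := by exact_mod_cast Finset.HasAntidiagonal.mem_antidiagonal.1 hp
    rw [this]; ring
  have h12 : ∑ p ∈ Finset.HasAntidiagonal.antidiagonal n, C (qc α β n p.1 p.2) *
      (C ((p.1:ℝ) * (p.1 + α)) * (X ^ (p.1 - 1) * (1 - X) ^ p.2)) +
      ∑ p ∈ Finset.HasAntidiagonal.antidiagonal n, C (qc α β n p.1 p.2) *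
      (C ((p.2:ℝ) * (p.2 + β)) * (X ^ p.1 * (1 - X) ^ (p.2 - 1))) = 0 := by
    rcases n with _ | m
    · simp
    · rw [Finset.Nat.sum_antidiagonal_succ, Finset.Nat.sum_antidiagonal_succ']
      simp only [Nat.cast_zero, zero_mul, map_zero, mul_zero, zero_add]
      rw [← Finset.sum_add_distrib]
      refine Finset.sum_eq_zero fun p hp => ?_
      have hp : (m:ℝ) = p.1 + p.2 := by exact_mod_cast (Finset.HasAntidiagonal.mem_antidiagonal.1 hp).symm
      have : qc α β (m + 1) (p.1 + 1) p.2 * (((p.1:ℝ) + 1) * (p.1 + 1 + α))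
         = - (qc α β (m + 1) p.1 (p.2 + 1) * (((p.2:ℝ) + 1) * (p.2 + 1 + β))) := by
        unfold qc
        rw [fall_succ, fall_succ, Nat.factorial_succ, Nat.factorial_succ]
        push_cast
        rw [hp]
        field_simp
        ring
      have h := congrArg (fun z : ℝ => C z) this
      simp only [map_mul, map_add, map_neg, map_one] at h
      simp only [Nat.add_sub_cancel, Nat.cast_add, Nat.cast_one, map_mul, map_add, map_one]
      linear_combination (X ^ p.1 * (1 - X) ^ p.2) * h
  conv_lhs => rw [Qp]
  rw [jL_sum]
  simp only [jL_smul, jL_mono, mul_sub, mul_add, Finset.sum_sub_distrib, Finset.sum_add_distrib]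
  simp only [mul_add] at h12 h3
  rw [h12, h3]
  simp only [map_neg, map_add]; ring

lemma Qp_eval_zero (α β : ℝ) (n : ℕ) : (Qp α β n).eval 0 = poch (α + 1) n / n.factorial := by
  simp only [Qp, Polynomial.eval_finsetSum]
  rw [Finset.sum_eq_single (0, n)]
  · simp [qc, fall_eq_poch]
  · rintro ⟨i, j⟩ h hne
    have : i ≠ 0 := by
      rintro rfl
      simp at h; simp [h] at hne
    simp [this]
  · simp

lemma Qp_eval_one (α β : ℝ) (n : ℕ) : (Qp α β n).eval 1 = (-1) ^ n * poch (β + 1) n / n.factorial := by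
  simp only [Qp, Polynomial.eval_finsetSum]
  rw [Finset.sum_eq_single (n, 0)]
  · simp [qc, fall_eq_poch]
  · rintro ⟨i, j⟩ h hne
    have : j ≠ 0 := by
      rintro rfl
      simp at h; simp [h] at hne
    simp [this]
  · simp

noncomputable def eR (α β a b : ℝ) (k : ℕ) : ℝ :=
  ∑ p ∈ Finset.HasAntidiagonal.antidiagonal k, wt α β p.1 p.2 * (a ^ p.1 * b ^ p.2)

lemma eP_eval (α β x y : ℝ) (k : ℕ) : (eP α β y k).eval x = eR α β (x * y) ((1 - x) * (1 - y)) k := by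
  simp only [eP, eR, Polynomial.eval_finsetSum]
  refine Finset.sum_congr rfl fun p _ => ?_
  simp [mul_pow]; ring

lemma eR_zero (α β a b : ℝ) : eR α β a b 0 = 1 := by
  simp [eR, wt]

lemma eR_00 (α β : ℝ) (k : ℕ) : eR α β 0 0 (k + 1) = 0 := by
  refine Finset.sum_eq_zero fun p hp => ?_
  have hp := Finset.HasAntidiagonal.mem_antidiagonal.1 hp
  by_cases h : p.1 = 0
  · have : p.2 ≠ 0 := by omega
    simp [this]
  · simp [h]

lemma S_eq {α β : ℝ} (hα : -1 < α) (hβ : -1 < β) (x y : ℝ) (n : ℕ) (d : ℕ → ℝ)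
    (hd : ∀ k < n, d (k + 1) = (k * (k + α + β + 1) - n * (n + α + β + 1)) * d k) :
    (∑ k ∈ Finset.range (n + 1), d k * eR α β (x * y) ((1 - x) * (1 - y)) k) *
      ((-1) ^ n * (poch (α + 1) n * poch (β + 1) n))
      = d 0 * (n.factorial : ℝ) ^ 2 * (Qp α β n).eval x * (Qp α β n).eval y := by
  set S : ℝ → ℝ → ℝ := fun x y => ∑ k ∈ Finset.range (n + 1), d k * eR α β (x * y) ((1 - x) * (1 - y)) k with hS
  have hev : ∀ x y, (∑ k ∈ Finset.range (n + 1), Polynomial.C (d k) * eP α β y k).eval x = S x y := by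
    intro x y
    simp [hS, Polynomial.eval_finsetSum, eP_eval]
  have hsymm : ∀ x y, S x y = S y x := by
    intro x y
    simp only [hS, mul_comm]
  have hu : ∀ x y, S x y * (Qp α β n).eval 0 = S 0 y * (Qp α β n).eval x := by
    intro x y
    rw [← hev, ← hev]
    exact jL_unique' α β hα _ _ _ (jL_S hα hβ y n d hd) (jL_Qp α β n) x
  have h10 : S 1 0 = d 0 := by
    simp only [hS]
    rw [Finset.sum_range_succ']
    simp [eR_00, eR_zero]
  have h1 := hu x y
  have h2 := hu y 0
  have h3 := hu 1 0
  rw [hsymm 0 y] at h1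
  rw [h10] at h3
  have hpa := (poch_pos (show 0 < α + 1 by linarith) n).ne'
  have hpb := (poch_pos (show 0 < β + 1 by linarith) n).ne'
  have h0 : (Qp α β n).eval 0 ≠ 0 := by
    rw [Qp_eval_zero]; positivity
  have hfin : S x y * ((Qp α β n).eval 0 * (Qp α β n).eval 1) = d 0 * (Qp α β n).eval x * (Qp α β n).eval y := by
    apply mul_left_cancel₀ h0
    linear_combination (Qp α β n).eval 0 * (Qp α β n).eval 1 * h1 + (Qp α β n).eval x * (Qp α β n).eval 1 * h2 - (Qp α β n).eval x * (Qp α β n).eval y * h3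
  rw [Qp_eval_zero, Qp_eval_one] at hfin
  change S x y * _ = _
  field_simp at hfin
  linear_combination hfin

end JP
namespace JP

lemma iter_one_sub (p : ℝ) (k : ℕ) : ∀ x < 1, iteratedDeriv k (fun y : ℝ => (1 - y) ^ p) x
    = (-1) ^ k * fall p k * (1 - x) ^ (p - k) := by
  induction k with
  | zero => intro x _; simp
  | succ k ih =>
    intro x hx
    rw [iteratedDeriv_succ]
    have h : iteratedDeriv k (fun y : ℝ => (1 - y) ^ p) =ᶠ[nhds x]
        fun x => (-1) ^ k * fall p k * (1 - x) ^ (p - k) := by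
      filter_upwards [Iio_mem_nhds hx] with y hy using ih y hy
    rw [h.deriv_eq]
    have h1 : HasDerivAt (fun x : ℝ => (1 - x)) (-1) x := by
      simpa using (hasDerivAt_id x).const_sub 1
    have h2 := (h1.rpow_const (p := p - k) (Or.inl (by linarith))).const_mul ((-1) ^ k * fall p k)
    rw [h2.deriv, fall_succ]
    push_cast
    rw [show p - ((k:ℝ) + 1) = p - k - 1 by ring]
    ring

lemma iter_one_add (p : ℝ) (k : ℕ) : ∀ x > -1, iteratedDeriv k (fun y : ℝ => (1 + y) ^ p) x
    = fall p k * (1 + x) ^ (p - k) := by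
  induction k with
  | zero => intro x _; simp
  | succ k ih =>
    intro x hx
    rw [iteratedDeriv_succ]
    have h : iteratedDeriv k (fun y : ℝ => (1 + y) ^ p) =ᶠ[nhds x]
        fun x => fall p k * (1 + x) ^ (p - k) := by
      filter_upwards [Ioi_mem_nhds hx] with y hy using ih y hy
    rw [h.deriv_eq]
    have h1 : HasDerivAt (fun x : ℝ => (1 + x)) 1 x := by
      simpa using (hasDerivAt_id x).const_add 1
    have h2 := (h1.rpow_const (p := p - k) (Or.inl (by linarith))).const_mul (fall p k)
    rw [h2.deriv, fall_succ]
    push_cast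
    rw [show p - ((k:ℝ) + 1) = p - k - 1 by ring]
    ring

lemma jacobiP_eq (α β : ℝ) (n : ℕ) (x : ℝ) (hx : x ∈ Ioo (-1:ℝ) 1) :
    jacobiP α β n x = (Qp α β n).eval ((1 - x) / 2) := by
  have ha : 0 < 1 - x := by linarith [hx.2]
  have hb : 0 < 1 + x := by linarith [hx.1]
  unfold jacobiP
  have hf : ContDiffAt ℝ n (fun y : ℝ => (1 - y) ^ ((n:ℝ) + α)) x :=
    (contDiffAt_const.sub contDiffAt_id).rpow_const_of_ne ha.ne'
  have hg : ContDiffAt ℝ n (fun y : ℝ => (1 + y) ^ ((n:ℝ) + β)) x :=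
    (contDiffAt_const.add contDiffAt_id).rpow_const_of_ne hb.ne'
  rw [iteratedDeriv_fun_mul hf hg, Qp, ← Finset.Nat.sum_antidiagonal_swap,
    Finset.Nat.sum_antidiagonal_eq_sum_range_succ_mk, Polynomial.eval_finsetSum, Finset.mul_sum]
  refine Finset.sum_congr rfl fun j hj => ?_
  have hj : j ≤ n := by have := Finset.mem_range.1 hj; omega
  obtain ⟨i, rfl⟩ := Nat.exists_eq_add_of_le' hj
  rw [iter_one_sub _ _ x hx.2, iter_one_add _ _ x hx.1]
  have e1 : (1 - x) ^ (((i + j : ℕ) : ℝ) + α - j) = (1 - x) ^ i * (1 - x) ^ α := by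
    rw [← Real.rpow_natCast, ← Real.rpow_add ha]; push_cast; ring_nf
  have e2 : (1 + x) ^ (((i + j : ℕ) : ℝ) + β - ((i + j - j : ℕ) : ℝ)) = (1 + x) ^ j * (1 + x) ^ β := by
    rw [← Real.rpow_natCast, ← Real.rpow_add hb, Nat.add_sub_cancel]; push_cast; ring_nf
  rw [e1, e2, Real.rpow_neg ha.le, Real.rpow_neg hb.le]
  have hA : (1 - x) ^ α ≠ 0 := (Real.rpow_pos_of_pos ha _).ne'
  have hB : (1 + x) ^ β ≠ 0 := (Real.rpow_pos_of_pos hb _).ne'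
  simp only [Nat.add_sub_cancel, Prod.swap, qc, Polynomial.eval_mul, Polynomial.eval_C,
    Polynomial.eval_pow, Polynomial.eval_sub, Polynomial.eval_X, Polynomial.eval_one]
  rw [show 1 - (1 - x) / 2 = (1 + x) / 2 by ring, Nat.cast_choose ℝ hj, Nat.add_sub_cancel]
  have hs : (-1:ℝ) ^ (i + j) * (-1) ^ j = (-1) ^ i := by
    rw [pow_add, mul_assoc, ← mul_pow]; simp
  rw [← hs, div_pow, div_pow, pow_add (2:ℝ)]
  field_simp

end JP
namespace JP

noncomputable def kc (γ : ℝ) : ℝ := Real.Gamma (γ + 1) / (Real.sqrt π * Real.Gamma (γ + 1/2))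

lemma kc_pos {γ : ℝ} (hγ : -(1/2) < γ) : 0 < kc γ := by
  unfold kc
  have h1 := Real.Gamma_pos_of_pos (show 0 < γ + 1 by linarith)
  have h2 := Real.Gamma_pos_of_pos (show 0 < γ + 1/2 by linarith)
  have := Real.pi_pos
  positivity

lemma beta_real {a : ℝ} (ha : 0 < a) :
    IntervalIntegrable (fun x : ℝ => x ^ (a - 1) * (1 - x) ^ (a - 1)) volume 0 1 ∧
    Real.Gamma a * Real.Gamma a =
      Real.Gamma (2 * a) * ∫ x in (0:ℝ)..1, x ^ (a - 1) * (1 - x) ^ (a - 1) := by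
  have hc := Complex.betaIntegral_convergent (u := (a:ℂ)) (v := (a:ℂ)) (by simpa) (by simpa)
  have hG := Complex.Gamma_mul_Gamma_eq_betaIntegral (s := (a:ℂ)) (t := (a:ℂ)) (by simpa) (by simpa)
  have heq : ∀ x ∈ Icc (0:ℝ) 1, (x : ℂ) ^ ((a:ℂ) - 1) * (1 - (x : ℂ)) ^ ((a:ℂ) - 1)
      = ((x ^ (a - 1) * (1 - x) ^ (a - 1) : ℝ) : ℂ) := by
    intro x hx
    rw [Complex.ofReal_mul, Complex.ofReal_cpow hx.1, Complex.ofReal_cpow (by linarith [hx.2])]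
    push_cast; rfl
  constructor
  · have h1 : IntervalIntegrable (fun x : ℝ => ((x ^ (a - 1) * (1 - x) ^ (a - 1) : ℝ) : ℂ)) volume 0 1 := by
      refine hc.congr ?_
      intro x hx
      rw [uIoc_of_le zero_le_one] at hx
      exact heq x ⟨hx.1.le, hx.2⟩
    rw [intervalIntegrable_iff] at h1 ⊢
    exact h1.re
  · have h2 : Complex.betaIntegral a a = ((∫ x in (0:ℝ)..1, x ^ (a - 1) * (1 - x) ^ (a - 1) : ℝ) : ℂ) := by
      rw [Complex.betaIntegral, ← intervalIntegral.integral_ofReal]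
      refine intervalIntegral.integral_congr fun x hx => ?_
      rw [uIcc_of_le zero_le_one] at hx
      exact heq x hx
    rw [h2, ← Complex.ofReal_add, Complex.Gamma_ofReal, Complex.Gamma_ofReal] at hG
    rw [two_mul]
    exact_mod_cast hG

lemma w_scale (γ : ℝ) (x : ℝ) (hx : x ∈ Icc (0:ℝ) 1) : (1 - (2 * x - 1) ^ 2) ^ (γ - 1/2)
    = 4 ^ (γ - 1/2) * (x ^ (γ + 1/2 - 1) * (1 - x) ^ (γ + 1/2 - 1)) := by
  have h1 : 0 ≤ 1 - x := by linarith [hx.2]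
  rw [show (1 - (2 * x - 1) ^ 2) = 4 * (x * (1 - x)) by ring,
    Real.mul_rpow (by norm_num) (mul_nonneg hx.1 h1), Real.mul_rpow hx.1 h1]
  ring_nf

lemma w_int {γ : ℝ} (hγ : -(1/2) < γ) :
    IntervalIntegrable (fun u : ℝ => (1 - u ^ 2) ^ (γ - 1/2)) volume (-1) 1 := by
  have h := (beta_real (a := γ + 1/2) (by linarith)).1.const_mul (4 ^ (γ - 1/2))
  have h2 : IntervalIntegrable (fun x : ℝ => (1 - (2 * x - 1) ^ 2) ^ (γ - 1/2)) volume 0 1 := by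
    refine h.congr ?_
    intro x hx
    rw [uIoc_of_le zero_le_one] at hx
    exact (w_scale γ x ⟨hx.1.le, hx.2⟩).symm
  have h3 := (h2.comp_mul_left (c := 1/2)).comp_add_right 1
  norm_num at h3
  convert h3 using 1
  ext u; ring_nf

lemma w_total {γ : ℝ} (hγ : -(1/2) < γ) :
    kc γ * ∫ u in (-1:ℝ)..1, (1 - u ^ 2) ^ (γ - 1/2) = 1 := by
  have h := (beta_real (a := γ + 1/2) (by linarith)).2
  have h1 := intervalIntegral.integral_comp_mul_sub (a := 0) (b := 1)
    (fun u : ℝ => (1 - u ^ 2) ^ (γ - 1/2)) (c := 2) (by norm_num) 1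
  have h2 : ∫ x in (0:ℝ)..1, (1 - (2 * x - 1) ^ 2) ^ (γ - 1/2)
     = 4 ^ (γ - 1/2) * ∫ x in (0:ℝ)..1, (x ^ (γ + 1/2 - 1) * (1 - x) ^ (γ + 1/2 - 1)) := by
    rw [← intervalIntegral.integral_const_mul]
    refine intervalIntegral.integral_congr fun x hx => ?_
    rw [uIcc_of_le zero_le_one] at hx
    exact w_scale γ x hx
  rw [h2] at h1
  norm_num at h1
  have hdup := Real.Gamma_mul_Gamma_add_half (γ + 1/2)
  rw [show γ + 1/2 + 1/2 = γ + 1 by ring] at hdup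
  have g1 := Real.Gamma_pos_of_pos (show 0 < γ + 1 by linarith)
  have g2 := Real.Gamma_pos_of_pos (show 0 < γ + 1/2 by linarith)
  have g3 := Real.Gamma_pos_of_pos (show 0 < 2 * (γ + 1/2) by linarith)
  have hpi := Real.pi_pos
  have e4 : (2:ℝ) ^ (1 - 2 * (γ + 1/2)) * (2 * 4 ^ (γ - 1/2)) = 1 := by
    rw [show (4:ℝ) = 2 ^ (2:ℝ) by norm_num, ← Real.rpow_mul (by norm_num)]
    rw [mul_left_comm, ← Real.rpow_add (by norm_num),
      show 1 - 2 * (γ + 1/2) + 2 * (γ - 1/2) = -1 by ring, Real.rpow_neg_one]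
    norm_num
  set J := ∫ x in (0:ℝ)..1, (x ^ (γ + 1/2 - 1) * (1 - x) ^ (γ + 1/2 - 1)) with hJ
  set I := ∫ u in (-1:ℝ)..1, (1 - u ^ 2) ^ (γ - 1/2) with hI
  have hI2 : I = 2 * 4 ^ (γ - 1/2) * J := by
    have : I = 2 * ((1/2) * I) := by ring
    rw [this]
    norm_num at *
    linarith
  unfold kc
  rw [div_mul_eq_mul_div, div_eq_one_iff_eq (by positivity)]
  have hs : Real.sqrt π ≠ 0 := by positivity
  apply mul_left_cancel₀ (mul_pos g2 g3).ne'
  rw [hI2]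
  calc _ = (Real.Gamma (γ + 1/2) * Real.Gamma (γ + 1)) * (Real.Gamma (2 * (γ + 1/2)) * J) * (2 * 4 ^ (γ - 1/2)) := by ring
    _ = (Real.Gamma (2 * (γ + 1/2)) * Real.sqrt π) * (Real.Gamma (γ + 1/2) * Real.Gamma (γ + 1/2)) * ((2:ℝ) ^ (1 - 2 * (γ + 1/2)) * (2 * 4 ^ (γ - 1/2))) := by
        rw [hdup, ← h]; ring
    _ = _ := by rw [e4]; ring


lemma pi_def {γ : ℝ} (hγ : -(1/2) < γ) : jacobiPiMeasure γ =
    (volume.restrict (Icc (-1 : ℝ) 1)).withDensity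
      (fun u => ENNReal.ofReal (kc γ * (1 - u ^ 2) ^ (γ - 1/2))) := by
  unfold jacobiPiMeasure kc
  rw [if_neg hγ.ne']

lemma meas_w (γ : ℝ) : Measurable (fun u : ℝ => kc γ * (1 - u ^ 2) ^ (γ - 1/2)) := by
  fun_prop

lemma w_intOn {γ : ℝ} (hγ : -(1/2) < γ) :
    Integrable (fun u : ℝ => kc γ * (1 - u ^ 2) ^ (γ - 1/2)) (volume.restrict (Icc (-1 : ℝ) 1)) := by
  refine Integrable.const_mul ?_ _
  have := w_int hγ
  rwa [intervalIntegrable_iff_integrableOn_Icc_of_le (by norm_num)] at this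

lemma pi_finite {γ : ℝ} (hγ : -(1/2) < γ) : IsFiniteMeasure (jacobiPiMeasure γ) := by
  rw [pi_def hγ]
  exact isFiniteMeasure_withDensity_ofReal (w_intOn hγ).2

lemma pi_ae {γ : ℝ} (hγ : -(1/2) < γ) : ∀ᵐ u ∂(jacobiPiMeasure γ), u ∈ Icc (-1:ℝ) 1 := by
  rw [pi_def hγ]
  exact (withDensity_absolutelyContinuous _ _).ae_le (ae_restrict_mem measurableSet_Icc)

lemma pi_integral {γ : ℝ} (hγ : -(1/2) < γ) (f : ℝ → ℝ) :
    ∫ u, f u ∂(jacobiPiMeasure γ) = kc γ * ∫ u in (-1:ℝ)..1, (1 - u ^ 2) ^ (γ - 1/2) * f u := by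
  rw [pi_def hγ, integral_withDensity_eq_integral_toReal_smul (meas_w γ).ennreal_ofReal
    (Filter.Eventually.of_forall fun _ => ENNReal.ofReal_lt_top),
    intervalIntegral.integral_of_le (by norm_num), integral_Icc_eq_integral_Ioc,
    ← integral_const_mul]
  refine setIntegral_congr_fun measurableSet_Ioc fun u hu => ?_
  have h : 0 ≤ kc γ * (1 - u ^ 2) ^ (γ - 1/2) :=
    mul_nonneg (kc_pos hγ).le (Real.rpow_nonneg (by nlinarith [hu.1, hu.2]) _)
  simp only [smul_eq_mul]
  rw [ENNReal.toReal_ofReal h]; ring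

lemma w_pow_int {γ : ℝ} (hγ : -(1/2) < γ) (m : ℕ) :
    IntervalIntegrable (fun u : ℝ => (1 - u ^ 2) ^ (γ - 1/2) * u ^ m) volume (-1) 1 :=
  (w_int hγ).mul_continuousOn (by fun_prop)

/-- moments -/
noncomputable def mom (γ : ℝ) (m : ℕ) : ℝ := ∫ u, u ^ m ∂(jacobiPiMeasure γ)

lemma mom_zero {γ : ℝ} (hγ : -(1/2) < γ) : mom γ 0 = 1 := by
  rw [mom, pi_integral hγ]
  simpa using w_total hγ

lemma w_split {γ : ℝ} {u : ℝ} (hu : u ∈ Ioo (-1:ℝ) 1) :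
    (1 - u ^ 2) ^ (γ + 1/2) = (1 - u ^ 2) * (1 - u ^ 2) ^ (γ - 1/2) := by
  have h : 0 < 1 - u ^ 2 := by nlinarith [hu.1, hu.2]
  rw [show γ + 1/2 = 1 + (γ - 1/2) by ring, Real.rpow_add h, Real.rpow_one]

lemma w_deriv (γ : ℝ) {u : ℝ} (hu : u ∈ Ioo (-1:ℝ) 1) :
    HasDerivAt (fun u : ℝ => (1 - u ^ 2) ^ (γ + 1/2)) (-(2 * γ + 1) * (u * (1 - u ^ 2) ^ (γ - 1/2))) u := by
  have h : 0 < 1 - u ^ 2 := by nlinarith [hu.1, hu.2]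
  have h1 : HasDerivAt (fun u : ℝ => 1 - u ^ 2) (-(2 * u)) u := by
    simpa using (hasDerivAt_pow 2 u).const_sub 1
  convert h1.rpow_const (p := γ + 1/2) (Or.inl h.ne') using 1
  rw [show γ + 1/2 - 1 = γ - 1/2 by ring]; ring

lemma w_cont {γ : ℝ} (hγ : -(1/2) < γ) : Continuous (fun u : ℝ => (1 - u ^ 2) ^ (γ + 1/2)) :=
  Continuous.rpow_const (by fun_prop) fun _ => Or.inr (by linarith)

lemma mom_one {γ : ℝ} (hγ : -(1/2) < γ) : mom γ 1 = 0 := by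
  rw [mom, pi_integral hγ]
  have h := intervalIntegral.integral_eq_sub_of_hasDerivAt_of_le (a := -1) (b := 1) (by norm_num)
    (w_cont hγ).continuousOn (fun u hu => w_deriv γ hu)
    (((w_pow_int hγ 1).const_mul (-(2 * γ + 1))).congr (fun u _ => by ring))
  rw [intervalIntegral.integral_const_mul] at h
  norm_num at h
  rcases h with h | h
  · linarith
  · simp only [pow_one, mul_comm] at h ⊢
    rw [h]; simp

lemma mom_succ {γ : ℝ} (hγ : -(1/2) < γ) (m : ℕ) :
    (m + 2 * γ + 2) * mom γ (m + 2) = (m + 1) * mom γ m := by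
  rw [mom, mom, pi_integral hγ, pi_integral hγ]
  have hd : ∀ u ∈ Ioo (-1:ℝ) 1, HasDerivAt (fun u : ℝ => u ^ (m + 1) * (1 - u ^ 2) ^ (γ + 1/2))
      ((m + 1) * ((1 - u ^ 2) ^ (γ - 1/2) * u ^ m) - (m + 2 * γ + 2) * ((1 - u ^ 2) ^ (γ - 1/2) * u ^ (m + 2))) u := by
    intro u hu
    refine ((hasDerivAt_pow (m + 1) u).fun_mul (w_deriv γ hu)).congr_deriv ?_
    rw [w_split hu]
    push_cast
    ring
  have i1 := (w_pow_int hγ m).const_mul ((m:ℝ) + 1)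
  have i2 := (w_pow_int hγ (m + 2)).const_mul ((m:ℝ) + 2 * γ + 2)
  have h := intervalIntegral.integral_eq_sub_of_hasDerivAt_of_le (a := -1) (b := 1) (by norm_num)
    (((continuous_pow (m + 1)).mul (w_cont hγ)).continuousOn) hd (i1.sub i2)
  rw [intervalIntegral.integral_sub i1 i2, intervalIntegral.integral_const_mul,
    intervalIntegral.integral_const_mul] at h
  have hz : (0:ℝ) ^ (γ + 1/2) = 0 := Real.zero_rpow (by linarith)
  simp only [Pi.mul_apply] at h
  rw [show (1:ℝ) - 1 ^ 2 = 0 by norm_num, show (1:ℝ) - (-1) ^ 2 = 0 by norm_num, hz] at h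
  simp only [mul_zero, sub_zero] at h
  linear_combination (-kc γ) * h

lemma mom_odd {γ : ℝ} (hγ : -(1/2) < γ) (i : ℕ) : mom γ (2 * i + 1) = 0 := by
  induction i with
  | zero => simpa using mom_one hγ
  | succ i ih =>
    have h := mom_succ hγ (2 * i + 1)
    rw [ih, mul_zero] at h
    rcases mul_eq_zero.1 h with h | h
    · have : (0:ℝ) ≤ i := i.cast_nonneg
      push_cast at h; linarith
    · rw [← h]; ring_nf

lemma mom_even {γ : ℝ} (hγ : -(1/2) < γ) (i : ℕ) :
    mom γ (2 * i) = ((2 * i).factorial : ℝ) / (4 ^ i * i.factorial * poch (γ + 1) i) := by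
  induction i with
  | zero => simpa using mom_zero hγ
  | succ i ih =>
    have h := mom_succ hγ (2 * i)
    rw [ih] at h
    have h0 : (0:ℝ) ≤ i := i.cast_nonneg
    have h1 : (0:ℝ) < γ + 1 + i := by linarith
    have h2 := poch_pos (show 0 < γ + 1 by linarith) i
    rw [poch_succ, show 2 * (i + 1) = 2 * i + 1 + 1 by ring, Nat.factorial_succ, Nat.factorial_succ,
      Nat.factorial_succ]
    push_cast at h ⊢
    have h3 : (2 * (i:ℝ) + 2 * γ + 2) ≠ 0 := by linarith
    apply mul_left_cancel₀ h3
    rw [h]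
    field_simp
    ring

end JP
namespace JP

lemma choose_poch (μ : ℝ) (n : ℕ) :
    Ring.choose ((μ:ℂ) + n - 1) n = ((poch μ n / n.factorial : ℝ) : ℂ) := by
  have h1 : Ring.choose ((μ:ℂ) + n - 1) n = Ring.multichoose (μ:ℂ) n := by
    rw [Ring.choose]; congr 1; ring
  have h2 := Ring.factorial_nsmul_multichoose_eq_ascPochhammer (μ:ℂ) n
  have h3 : ∀ m : ℕ, (ascPochhammer ℕ m).smeval (μ:ℂ) = ((poch μ m : ℝ) : ℂ) := by
    intro m
    rw [Polynomial.ascPochhammer_smeval_eq_eval]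
    induction m with
    | zero => simp [poch_zero]
    | succ m ih => rw [ascPochhammer_succ_eval, ih, poch_succ]; push_cast; ring
  rw [h3, nsmul_eq_mul] at h2
  rw [h1]
  push_cast
  rw [eq_div_iff (by exact_mod_cast n.factorial_ne_zero), mul_comm]
  exact h2

lemma binom_hasSum (μ : ℝ) (w : ℂ) (hw : ‖w‖ < 1) :
    HasSum (fun k : ℕ => ((poch μ k / k.factorial : ℝ) : ℂ) * w ^ k) (1 / (1 - w) ^ (μ:ℂ)) := by
  have h := (Complex.one_div_one_sub_cpow_hasFPowerSeriesOnBall_zero (μ:ℂ)).hasSum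
    (y := w) (by simpa [Metric.mem_eball, edist_zero_right, ← ofReal_norm] using hw)
  simp only [zero_add] at h
  simpa only [FormalMultilinearSeries.ofScalars_apply_eq, choose_poch, smul_eq_mul] using h

lemma anti_sum (μ : ℝ) {K : Type*} [Field K] [CharZero K] (c : ℕ → K) (w1 w2 : K) (k : ℕ) :
    ∑ p ∈ Finset.HasAntidiagonal.antidiagonal k,
      (c (p.1 + p.2) / (p.1.factorial * p.2.factorial)) * (w1 ^ p.1 * w2 ^ p.2)
    = c k / k.factorial * (w1 + w2) ^ k := by
  rw [(Commute.all w1 w2).add_pow', Finset.mul_sum]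
  refine Finset.sum_congr rfl fun p hp => ?_
  rw [Finset.HasAntidiagonal.mem_antidiagonal] at hp
  subst hp
  have := Nat.add_choose_mul_factorial_mul_factorial p.1 p.2
  rw [Nat.choose_symm_add.symm] at this
  rw [nsmul_eq_mul, ← this]
  have h1 : (p.1.factorial:K) ≠ 0 := by exact_mod_cast p.1.factorial_ne_zero
  have h2 : (p.2.factorial:K) ≠ 0 := by exact_mod_cast p.2.factorial_ne_zero
  have h3 : ((p.1+p.2).choose p.1:K) ≠ 0 := by
    exact_mod_cast (Nat.choose_pos (Nat.le_add_right _ _)).ne'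
  push_cast
  field_simp

lemma dbl_hasSum (μ : ℝ) (hμ : 0 < μ) (w1 w2 : ℂ) (hw : ‖w1‖ + ‖w2‖ < 1) :
    HasSum (fun p : ℕ × ℕ =>
      ((poch μ (p.1 + p.2) : ℂ) / (p.1.factorial * p.2.factorial)) * (w1 ^ p.1 * w2 ^ p.2))
      (1 / (1 - (w1 + w2)) ^ (μ:ℂ)) := by
  have hs : Summable (fun p : ℕ × ℕ =>
      ((poch μ (p.1 + p.2) : ℂ) / (p.1.factorial * p.2.factorial)) * (w1 ^ p.1 * w2 ^ p.2)) := by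
    apply Summable.of_norm
    have : (fun p : ℕ × ℕ =>
      ‖((poch μ (p.1 + p.2) : ℂ) / (p.1.factorial * p.2.factorial)) * (w1 ^ p.1 * w2 ^ p.2)‖)
      = fun p : ℕ × ℕ => (poch μ (p.1 + p.2) / (p.1.factorial * p.2.factorial))
          * (‖w1‖ ^ p.1 * ‖w2‖ ^ p.2) := by
      funext p
      simp [abs_of_pos (poch_pos hμ _)]
    rw [this, ← Finset.HasAntidiagonal.sigmaAntidiagonalEquivProd.summable_iff,
      summable_sigma_of_nonneg]
    · refine ⟨fun k => (hasSum_fintype _).summable, ?_⟩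
      have h := (binom_hasSum μ (‖w1‖ + ‖w2‖ : ℝ) (by
        rw [Complex.norm_real, Real.norm_of_nonneg (by positivity)]; exact hw)).summable.norm
      refine h.congr fun k => ?_
      rw [tsum_fintype]
      simp only [Function.comp_apply, Finset.HasAntidiagonal.sigmaAntidiagonalEquivProd_apply]
      rw [Finset.sum_coe_sort (Finset.HasAntidiagonal.antidiagonal k) (fun p : ℕ × ℕ =>
        (poch μ (p.1 + p.2) / (p.1.factorial * p.2.factorial)) * (‖w1‖ ^ p.1 * ‖w2‖ ^ p.2)),
        anti_sum μ (poch μ)]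
      rw [← Complex.ofReal_pow, ← Complex.ofReal_mul, Complex.norm_real, Real.norm_of_nonneg]
      have := poch_pos hμ k
      positivity
    · intro p
      have := poch_pos hμ ((p.2:ℕ×ℕ).1 + (p.2:ℕ×ℕ).2)
      simp only [Function.comp_apply, Finset.HasAntidiagonal.sigmaAntidiagonalEquivProd_apply]
      positivity
  have h2 := (Finset.HasAntidiagonal.sigmaAntidiagonalEquivProd.hasSum_iff).2 hs.hasSum
  have h3 := h2.sigma (fun k => hasSum_fintype _)
  have h4 : ∀ k : ℕ, ∑ p : (Finset.HasAntidiagonal.antidiagonal k), ((fun p : ℕ × ℕ =>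
      ((poch μ (p.1 + p.2) : ℂ) / (p.1.factorial * p.2.factorial)) * (w1 ^ p.1 * w2 ^ p.2)) ∘ Finset.HasAntidiagonal.sigmaAntidiagonalEquivProd) ⟨k, p⟩ = ((poch μ k / k.factorial : ℝ) : ℂ) * (w1 + w2) ^ k := by
    intro k
    simp only [Function.comp_apply, Finset.HasAntidiagonal.sigmaAntidiagonalEquivProd_apply]
    rw [Finset.sum_coe_sort (Finset.HasAntidiagonal.antidiagonal k) (fun p : ℕ × ℕ =>
        ((poch μ (p.1 + p.2) : ℂ) / (p.1.factorial * p.2.factorial)) * (w1 ^ p.1 * w2 ^ p.2)),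
        anti_sum μ (fun k => (poch μ k : ℂ))]
    push_cast
    ring
  simp only [h4] at h3
  have h5 := binom_hasSum μ (w1 + w2) ((norm_add_le _ _).trans_lt hw)
  rw [← h3.unique h5]
  exact hs.hasSum

end JP
namespace JP

/-- Coefficient of the expansion. -/
noncomputable def cG (l : ℝ) (i j : ℕ) : ℝ :=
  poch l (i + j) * (l + i + 2 * j) / (l * (i.factorial * j.factorial))

/-- Coefficient with the second index doubled. -/
noncomputable def gF (l : ℝ) (z : ℝ) (p : ℕ × ℕ) : ℝ :=
  if Even p.2 then cG l p.1 (p.2 / 2) * (2 * z) ^ p.1 * (-1) ^ (p.2 / 2) else 0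

/-- The expansion polynomials. -/
noncomputable def gP (l : ℝ) (m : ℕ) (z : ℝ) : ℝ :=
  ∑ p ∈ Finset.HasAntidiagonal.antidiagonal m, gF l z p

lemma poch_shift (l : ℝ) (n : ℕ) : poch l (n + 1) = l * poch (l + 1) n := by
  induction n with
  | zero => simp [poch_succ, poch_zero]
  | succ n ih => rw [poch_succ, ih, poch_succ]; push_cast; ring

lemma dbl2_hasSum (l : ℝ) (hl : 0 < l) (w1 w2 : ℂ) (hw : ‖w1‖ + ‖w2‖ < 1) :
    HasSum (fun p : ℕ × ℕ => (cG l p.1 p.2 : ℂ) * (w1 ^ p.1 * w2 ^ p.2))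
      ((1 + w2) * (1 / (1 - (w1 + w2)) ^ ((l + 1 : ℝ):ℂ))) := by
  have hA := dbl_hasSum (l + 1) (by linarith) w1 w2 hw
  have hB := hA.mul_left w2
  let b : ℕ × ℕ → ℂ := fun p => if p.2 = 0 then 0 else
    ((poch (l+1) (p.1 + (p.2 - 1)) : ℂ) / (p.1.factorial * (p.2 - 1).factorial)) * (w1 ^ p.1 * w2 ^ p.2)
  have hinj : Function.Injective (fun p : ℕ × ℕ => (p.1, p.2 + 1)) := by
    rintro ⟨a, b⟩ ⟨c, d⟩ h
    simpa using h
  have hb : HasSum b (w2 * (1 / (1 - (w1 + w2)) ^ ((l + 1 : ℝ):ℂ))) := by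
    rw [← hinj.hasSum_iff]
    · convert! hB using 2 with p
      simp [b, pow_succ]
      ring
    · rintro ⟨i, j⟩ h
      have : j = 0 := by
        by_contra hj
        exact h ⟨(i, j - 1), by simp; omega⟩
      simp [b, this]
  have h := hA.add hb
  rw [add_mul, one_mul]
  convert! h using 2 with p
  · obtain ⟨i, j⟩ := p
    have hi : (i.factorial:ℂ) ≠ 0 := by exact_mod_cast i.factorial_ne_zero
    have hj : (j.factorial:ℂ) ≠ 0 := by exact_mod_cast j.factorial_ne_zero
    have hl' : (l:ℂ) ≠ 0 := by exact_mod_cast hl.ne'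
    have e1 : l * poch (l + 1) (i + j) = poch l (i + j) * (l + (i + j : ℕ)) := by
      rw [← poch_shift, poch_succ]
    rcases j with _ | j
    · simp only [b, cG]
      have e1' : (l:ℂ) * poch (l + 1) i = poch l i * (l + i) := by
        simp at e1; exact_mod_cast e1
      push_cast
      simp
      field_simp
      left
      linear_combination - e1'
    · simp only [b, cG]
      have e2 := poch_shift l (i + j)
      have e3 := poch_succ (l+1) (i + j)
      have hj' : (j.factorial:ℂ) ≠ 0 := by exact_mod_cast j.factorial_ne_zero
      have hj1 : (j:ℂ) + 1 ≠ 0 := by exact_mod_cast Nat.succ_ne_zero j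
      rw [show i + (j+1) = i + j + 1 by ring, e2]
      simp only [Nat.add_sub_cancel, Nat.factorial_succ]
      rw [e3, if_neg (Nat.succ_ne_zero j)]
      push_cast
      field_simp
      ring

lemma small_hasSum (l : ℝ) (hl : 0 < l) (z : ℝ) (hz : |z| ≤ 1) (s : ℂ) (hs : ‖s‖ < 1/3) :
    HasSum (fun m : ℕ => (gP l m z : ℂ) * s ^ m)
      ((1 - s ^ 2) * (1 / (1 - 2 * s * z + s ^ 2) ^ ((l + 1 : ℝ):ℂ))) := by
  have h0 := norm_nonneg s
  have h := dbl2_hasSum l hl (2 * s * z) (-s ^ 2) (by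
    simp only [norm_mul, norm_neg, norm_pow, Complex.norm_real, Real.norm_eq_abs]
    norm_num
    nlinarith [abs_nonneg z])
  have hinj : Function.Injective (fun p : ℕ × ℕ => (p.1, 2 * p.2)) := by
    rintro ⟨a, b⟩ ⟨c, d⟩ h
    simpa using h
  have h2 : HasSum (fun p : ℕ × ℕ => (gF l z p : ℂ) * s ^ (p.1 + p.2))
      ((1 - s ^ 2) * (1 / (1 - 2 * s * z + s ^ 2) ^ ((l + 1 : ℝ):ℂ))) := by
    rw [← hinj.hasSum_iff]
    · rw [show (1 - s ^ 2) * (1 / (1 - 2 * s * z + s ^ 2) ^ ((l + 1 : ℝ):ℂ)) =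
        (1 + -s ^ 2) * (1 / (1 - (2 * s * z + -s ^ 2)) ^ ((l + 1 : ℝ):ℂ)) by ring_nf]
      convert! h using 2 with p
      · simp [gF]
        rw [neg_pow (s^2)]
        ring
    · rintro ⟨i, j⟩ h
      have : ¬ Even j := by
        rintro ⟨k, hk⟩
        exact h ⟨(i, k), by simp; omega⟩
      simp [gF, this]
  have h3 := (Finset.HasAntidiagonal.sigmaAntidiagonalEquivProd.hasSum_iff).2 h2
  have h4 := h3.sigma (fun k => hasSum_fintype _)
  have h5 : ∀ k : ℕ, ∑ p : (Finset.HasAntidiagonal.antidiagonal k), ((fun p : ℕ × ℕ =>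
      (gF l z p : ℂ) * s ^ (p.1 + p.2)) ∘ Finset.HasAntidiagonal.sigmaAntidiagonalEquivProd) ⟨k, p⟩
      = (gP l k z : ℂ) * s ^ k := by
    intro k
    simp only [Function.comp_apply, Finset.HasAntidiagonal.sigmaAntidiagonalEquivProd_apply]
    rw [Finset.sum_coe_sort (Finset.HasAntidiagonal.antidiagonal k) (fun p : ℕ × ℕ =>
        (gF l z p : ℂ) * s ^ (p.1 + p.2)), gP]
    push_cast
    rw [Finset.sum_mul]
    refine Finset.sum_congr rfl fun p hp => ?_
    rw [Finset.HasAntidiagonal.mem_antidiagonal] at hp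
    rw [hp]
  simpa only [h5] using h4

end JP
namespace JP

lemma slit (s : ℂ) (z : ℝ) (hs : ‖s‖ < 1) (hz : |z| ≤ 1) :
    1 - 2 * s * z + s ^ 2 ∈ Complex.slitPlane := by
  rw [Complex.mem_slitPlane_iff]
  by_contra hcon
  push Not at hcon
  obtain ⟨h1, h2⟩ := hcon
  have hn : s.re ^ 2 + s.im ^ 2 < 1 := by
    have := Complex.sq_norm s
    rw [Complex.normSq_apply] at this
    nlinarith [norm_nonneg s]
  have e1 : (1 - 2 * s * z + s ^ 2).re = 1 - 2 * s.re * z + s.re ^ 2 - s.im ^ 2 := by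
    simp [pow_two]; ring
  have e2 : (1 - 2 * s * z + s ^ 2).im = 2 * s.im * (s.re - z) := by
    simp [pow_two]; ring
  rw [e1] at h1
  rw [e2] at h2
  obtain ⟨hz1, hz2⟩ := abs_le.1 hz
  rcases mul_eq_zero.1 h2 with h | h
  · have h : s.im = 0 := by linarith
    rw [h] at h1 hn
    have : |s.re| < 1 := by
      rw [← sq_lt_one_iff_abs_lt_one]; linarith
    obtain ⟨h3, h4⟩ := abs_lt.1 this
    have p1 : 0 < (1 - s.re) ^ 2 := by apply pow_pos; linarith
    have p2 : 0 < (1 + s.re) ^ 2 := by apply pow_pos; linarith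
    rcases le_total 0 s.re with h5 | h5
    · nlinarith [mul_nonneg h5 (sub_nonneg.2 hz2)]
    · nlinarith [mul_nonneg (neg_nonneg.2 h5) (by linarith : 0 ≤ 1 + z)]
  · have h : z = s.re := by linarith
    rw [h] at h1
    nlinarith

/-- The complex generating function. -/
noncomputable def fG (l z : ℝ) (s : ℂ) : ℂ :=
  (1 - s ^ 2) * (1 / (1 - 2 * s * z + s ^ 2) ^ ((l + 1 : ℝ):ℂ))

lemma fG_diff (l z : ℝ) (hz : |z| ≤ 1) {ρ : ℝ} (hρ : ρ < 1) :
    DifferentiableOn ℂ (fG l z) (Metric.closedBall 0 ρ) := by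
  intro s hs
  have hs' : ‖s‖ < 1 := by simpa using (mem_closedBall_zero_iff.1 hs).trans_lt hρ
  apply DifferentiableAt.differentiableWithinAt
  unfold fG
  have h := slit s z hs' hz
  refine DifferentiableAt.mul (by fun_prop) (DifferentiableAt.div (by fun_prop) ?_ ?_)
  · exact DifferentiableAt.cpow (by fun_prop) (by fun_prop) h
  · rw [Complex.cpow_def_of_ne_zero (Complex.slitPlane_ne_zero h)]
    exact Complex.exp_ne_zero _

lemma fG_bound (l : ℝ) {ρ : ℝ} (hρ : ρ < 1) :
    ∃ M, ∀ z : ℝ, |z| ≤ 1 → ∀ s : ℂ, ‖s‖ ≤ ρ → ‖fG l z s‖ ≤ M := by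
  have hK : IsCompact ((Icc (-1:ℝ) 1) ×ˢ (Metric.closedBall (0:ℂ) ρ)) :=
    isCompact_Icc.prod (isCompact_closedBall _ _)
  have hc : ContinuousOn (fun p : ℝ × ℂ => fG l p.1 p.2)
      ((Icc (-1:ℝ) 1) ×ˢ (Metric.closedBall (0:ℂ) ρ)) := by
    rintro ⟨z, s⟩ ⟨hz, hs⟩
    have hs' : ‖s‖ < 1 := by simpa using (mem_closedBall_zero_iff.1 hs).trans_lt hρ
    have h := slit s z hs' (abs_le.2 hz)
    apply ContinuousAt.continuousWithinAt
    unfold fG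
    refine ContinuousAt.mul (by fun_prop) (ContinuousAt.div (by fun_prop) ?_ ?_)
    · exact ContinuousAt.cpow (by fun_prop) (by fun_prop) h
    · rw [Complex.cpow_def_of_ne_zero (Complex.slitPlane_ne_zero h)]
      exact Complex.exp_ne_zero _
  obtain ⟨M, hM⟩ := hK.exists_bound_of_continuousOn hc
  exact ⟨M, fun z hz s hs => hM (z, s) ⟨abs_le.1 hz, mem_closedBall_zero_iff.2 hs⟩⟩

lemma fG_coeff (l : ℝ) (hl : 0 < l) (z : ℝ) (hz : |z| ≤ 1) {ρ : NNReal} (h0 : 0 < ρ) (hρ : ρ < 1) (m : ℕ) :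
    (cauchyPowerSeries (fG l z) 0 ρ).coeff m = (gP l m z : ℂ) := by
  have h1 := ((fG_diff l z hz (ρ := ρ) (by exact_mod_cast hρ)).hasFPowerSeriesOnBall h0).hasFPowerSeriesAt
  have h2 : HasFPowerSeriesAt (fG l z)
      (FormalMultilinearSeries.ofScalars ℂ (fun m => (gP l m z : ℂ))) 0 := by
    rw [hasFPowerSeriesAt_iff]
    filter_upwards [Metric.ball_mem_nhds (0:ℂ) (show (0:ℝ) < 1/3 by norm_num)] with s hs
    have := small_hasSum l hl z hz s (by simpa using hs)
    simp only [FormalMultilinearSeries.coeff_ofScalars, smul_eq_mul, zero_add]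
    rw [← fG] at this
    convert! this using 2 with m
    rw [mul_comm]
  rw [h1.eq_formalMultilinearSeries h2, FormalMultilinearSeries.coeff_ofScalars]

lemma gP_main (l : ℝ) (hl : 0 < l) {ρ : ℝ} (h0 : 0 < ρ) (hρ : ρ < 1) :
    ∃ M, ∀ z : ℝ, |z| ≤ 1 → (∀ m, |gP l m z| ≤ M * ρ⁻¹ ^ m) ∧
      ∀ s : ℝ, 0 ≤ s → s < ρ → HasSum (fun m => gP l m z * s ^ m)
        ((1 - s ^ 2) * (1 / (1 - 2 * s * z + s ^ 2) ^ (l + 1))) := by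
  obtain ⟨M, hM⟩ := fG_bound l hρ
  refine ⟨M, fun z hz => ?_⟩
  lift ρ to NNReal using h0.le
  have h0' : 0 < ρ := by exact_mod_cast h0
  have hρ' : ρ < 1 := by exact_mod_cast hρ
  refine ⟨fun m => ?_, fun s hs hsρ => ?_⟩
  · have h1 := norm_cauchyPowerSeries_le (fG l z) 0 ρ m
    have h2 := (cauchyPowerSeries (fG l z) 0 ρ).norm_apply_eq_norm_coef (n := m)
    rw [h2, fG_coeff l hl z hz h0' hρ', Complex.norm_real, Real.norm_eq_abs] at h1
    refine h1.trans ?_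
    rw [abs_of_pos h0]
    gcongr
    have h3 : ∫ θ : ℝ in 0..2 * π, ‖fG l z (circleMap 0 ρ θ)‖ ≤ ∫ θ : ℝ in 0..2*π, M := by
      apply intervalIntegral.integral_mono_on (by positivity)
      · apply Continuous.intervalIntegrable
        have : ContinuousOn (fG l z) (Metric.closedBall 0 ρ) := (fG_diff l z hz hρ).continuousOn
        refine Continuous.norm (this.comp_continuous (continuous_circleMap _ _) fun x => ?_)
        exact circleMap_mem_closedBall _ h0.le _
      · simp
      · intro x _
        exact hM z hz _ (by simp [circleMap])
    rw [intervalIntegral.integral_const, smul_eq_mul, sub_zero] at h3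
    rw [inv_mul_le_iff₀ (by positivity)]
    exact h3
  · have h1 := ((fG_diff l z hz (ρ := ρ) hρ).hasFPowerSeriesOnBall h0').hasSum (y := (s:ℂ)) (by
      rw [Metric.mem_eball, edist_zero_right, ← ofReal_norm, Complex.norm_real, Real.norm_of_nonneg hs]
      rw [← ENNReal.ofReal_coe_nnreal]
      exact (ENNReal.ofReal_lt_ofReal_iff h0).2 hsρ)
    simp only [FormalMultilinearSeries.apply_eq_prod_smul_coeff, fG_coeff l hl z hz h0' hρ', zero_add,
      Finset.prod_const, Finset.card_univ, Fintype.card_fin, smul_eq_mul] at h1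
    rw [← Complex.hasSum_ofReal]
    have hpos : 0 ≤ 1 - 2 * s * z + s ^ 2 := by
      obtain ⟨hz1, hz2⟩ := abs_le.1 hz
      nlinarith
    convert! h1 using 1
    · funext m
      push_cast; ring
    · rw [fG]
      push_cast [Complex.ofReal_cpow hpos]
      rfl

end JP
namespace JP

lemma gP_cont (l : ℝ) (m : ℕ) : Continuous (gP l m) := by
  unfold gP
  refine continuous_finsetSum _ fun p _ => ?_
  unfold gF
  split_ifs <;> fun_prop

lemma z_bound {A B u v : ℝ} (hAB : |A| + |B| ≤ 1) (hu : u ∈ Icc (-1:ℝ) 1) (hv : v ∈ Icc (-1:ℝ) 1) :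
    |u * A + v * B| ≤ 1 := by
  have h1 : |u| ≤ 1 := abs_le.2 hu
  have h2 : |v| ≤ 1 := abs_le.2 hv
  calc |u * A + v * B| ≤ |u| * |A| + |v| * |B| := by
        rw [← abs_mul, ← abs_mul]; exact abs_add_le _ _
    _ ≤ 1 * |A| + 1 * |B| := by gcongr
    _ ≤ 1 := by linarith

lemma int_hasSum {α β A B l s : ℝ} (hα : -(1/2) < α) (hβ : -(1/2) < β) (hl : 0 < l)
    (hAB : |A| + |B| ≤ 1) (hs0 : 0 ≤ s) (hs1 : s < 1) :
    HasSum (fun m => (∫ v, ∫ u, gP l m (u * A + v * B) ∂(jacobiPiMeasure α) ∂(jacobiPiMeasure β)) * s ^ m)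
      (∫ v, ∫ u, (1 - s ^ 2) * (1 / (1 - 2 * s * (u * A + v * B) + s ^ 2) ^ (l + 1))
        ∂(jacobiPiMeasure α) ∂(jacobiPiMeasure β)) := by
  have := pi_finite hα
  have := pi_finite hβ
  obtain ⟨ρ, hρ0, hρ1⟩ := exists_between hs1
  have hρp : 0 < ρ := by linarith
  obtain ⟨M, hM⟩ := gP_main l hl hρp hρ1
  have hsum : Summable (fun m : ℕ => M * (ρ⁻¹ * s) ^ m) := by
    refine (summable_geometric_of_lt_one (by positivity) ?_).mul_left M
    rw [inv_mul_lt_iff₀ hρp]; linarith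
  have hb : ∀ u ∈ Icc (-1:ℝ) 1, ∀ v ∈ Icc (-1:ℝ) 1, ∀ m,
      ‖gP l m (u * A + v * B) * s ^ m‖ ≤ M * (ρ⁻¹ * s) ^ m := by
    intro u hu v hv m
    rw [norm_mul, Real.norm_eq_abs, Real.norm_of_nonneg (by positivity), mul_pow, ← mul_assoc]
    gcongr
    exact (hM _ (z_bound hAB hu hv)).1 m
  have hin : ∀ v ∈ Icc (-1:ℝ) 1, HasSum (fun m => ∫ u, gP l m (u * A + v * B) * s ^ m ∂(jacobiPiMeasure α))
      (∫ u, (1 - s ^ 2) * (1 / (1 - 2 * s * (u * A + v * B) + s ^ 2) ^ (l + 1)) ∂(jacobiPiMeasure α)) := by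
    intro v hv
    refine hasSum_integral_of_dominated_convergence (fun m _ => M * (ρ⁻¹ * s) ^ m) ?_ ?_ ?_ ?_ ?_
    · intro m
      have := gP_cont l m
      exact Continuous.aestronglyMeasurable (by fun_prop)
    · intro m
      filter_upwards [pi_ae hα] with u hu using hb u hu v hv m
    · exact Filter.Eventually.of_forall fun _ => hsum
    · exact integrable_const _
    · filter_upwards [pi_ae hα] with u hu using (hM _ (z_bound hAB hu hv)).2 s hs0 hρ0
  simp_rw [← integral_mul_const]
  refine hasSum_integral_of_dominated_convergence
    (fun m _ => M * (ρ⁻¹ * s) ^ m * (jacobiPiMeasure α).real univ) ?_ ?_ ?_ ?_ ?_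
  · intro m
    have := gP_cont l m
    refine (StronglyMeasurable.integral_prod_right (ν := jacobiPiMeasure α)
      (f := fun v u : ℝ => gP l m (u * A + v * B) * s ^ m) ?_).aestronglyMeasurable
    apply Continuous.stronglyMeasurable
    unfold Function.uncurry
    fun_prop
  · intro m
    filter_upwards [pi_ae hβ] with v hv
    apply norm_integral_le_of_norm_le_const
    filter_upwards [pi_ae hα] with u hu using hb u hu v hv m
  · exact Filter.Eventually.of_forall fun _ => hsum.mul_right _
  · exact integrable_const _
  · filter_upwards [pi_ae hβ] with v hv using hin v hv

lemma pow_integrable {γ : ℝ} (hγ : -(1/2) < γ) (m : ℕ) :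
    Integrable (fun u : ℝ => u ^ m) (jacobiPiMeasure γ) := by
  have := pi_finite hγ
  refine Integrable.of_bound (C := 1) (Continuous.aestronglyMeasurable (by fun_prop)) ?_
  filter_upwards [pi_ae hγ] with u hu
  rw [norm_pow]
  exact pow_le_one₀ (norm_nonneg _) (abs_le.2 hu)

/-- Coefficient in the double moment. -/
noncomputable def jm (α β A B : ℝ) (m : ℕ) : ℝ :=
  ∑ p ∈ Finset.HasAntidiagonal.antidiagonal m,
    (m.choose p.1 : ℝ) * (A ^ p.1 * B ^ p.2) * (mom α p.1 * mom β p.2)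

lemma expand_pow (A B u v : ℝ) (m : ℕ) : (u * A + v * B) ^ m =
    ∑ p ∈ Finset.HasAntidiagonal.antidiagonal m,
      ((m.choose p.1 : ℝ) * (A ^ p.1 * B ^ p.2) * v ^ p.2) * u ^ p.1 := by
  rw [(Commute.all (u * A) (v * B)).add_pow']
  refine Finset.sum_congr rfl fun p _ => ?_
  rw [nsmul_eq_mul, mul_pow, mul_pow]; ring

lemma inner_pow {α : ℝ} (hα : -(1/2) < α) (A B v : ℝ) (m : ℕ) :
    ∫ u, (u * A + v * B) ^ m ∂(jacobiPiMeasure α) =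
    ∑ p ∈ Finset.HasAntidiagonal.antidiagonal m,
      ((m.choose p.1 : ℝ) * (A ^ p.1 * B ^ p.2) * mom α p.1) * v ^ p.2 := by
  simp_rw [expand_pow]
  rw [integral_finsetSum _ fun p _ => (pow_integrable hα _).const_mul _]
  refine Finset.sum_congr rfl fun p _ => ?_
  rw [integral_const_mul, mom]; ring

lemma gF_eq (l z : ℝ) (p : ℕ × ℕ) : gF l z p = gF l 1 (p.1, p.2) * z ^ p.1 := by
  unfold gF
  simp only
  split_ifs
  · rw [mul_pow, mul_one]; ring
  · simp

lemma dbl_int {α β : ℝ} (hα : -(1/2) < α) (hβ : -(1/2) < β) (A B l : ℝ) (m : ℕ) :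
    ∫ v, ∫ u, gP l m (u * A + v * B) ∂(jacobiPiMeasure α) ∂(jacobiPiMeasure β) =
    ∑ p ∈ Finset.HasAntidiagonal.antidiagonal m, gF l 1 p * jm α β A B p.1 := by
  have h1 : ∀ v, ∫ u, gP l m (u * A + v * B) ∂(jacobiPiMeasure α) =
      ∑ p ∈ Finset.HasAntidiagonal.antidiagonal m, gF l 1 p *
        ∑ q ∈ Finset.HasAntidiagonal.antidiagonal p.1,
          ((p.1.choose q.1 : ℝ) * (A ^ q.1 * B ^ q.2) * mom α q.1) * v ^ q.2 := by
    intro v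
    unfold gP
    simp_rw [fun z => Finset.sum_congr rfl fun p (_ : p ∈ Finset.HasAntidiagonal.antidiagonal m) => gF_eq l z p]
    rw [integral_finsetSum]
    · refine Finset.sum_congr rfl fun p _ => ?_
      rw [integral_const_mul, inner_pow hα]
    · intro p _
      apply Integrable.const_mul
      simp_rw [expand_pow]
      exact integrable_finsetSum _ fun p _ => (pow_integrable hα _).const_mul _
  simp_rw [h1]
  rw [integral_finsetSum]
  · refine Finset.sum_congr rfl fun p _ => ?_
    rw [integral_const_mul, integral_finsetSum _ fun p _ => (pow_integrable hβ _).const_mul _, jm]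
    congr 1
    refine Finset.sum_congr rfl fun q _ => ?_
    rw [integral_const_mul, ← mom]; ring
  · intro p _
    apply Integrable.const_mul
    exact integrable_finsetSum _ fun p _ => (pow_integrable hβ _).const_mul _

lemma mom_odd' {γ : ℝ} (hγ : -(1/2) < γ) {i : ℕ} (hi : Odd i) : mom γ i = 0 := by
  obtain ⟨k, rfl⟩ := hi
  exact mom_odd hγ k

lemma jm_odd {α β : ℝ} (hα : -(1/2) < α) (hβ : -(1/2) < β) (A B : ℝ) {m : ℕ} (hm : Odd m) :
    jm α β A B m = 0 := by
  refine Finset.sum_eq_zero fun p hp => ?_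
  rw [Finset.HasAntidiagonal.mem_antidiagonal] at hp
  rw [← hp, Nat.odd_add] at hm
  rcases Nat.even_or_odd p.1 with h | h
  · rw [mom_odd' hβ (i := p.2) ?_]; · simp
    by_contra h'
    rw [Nat.not_odd_iff_even] at h'
    exact (Nat.not_odd_iff_even.2 h) (hm.2 h')
  · rw [mom_odd' hα h]; simp

lemma even_sum (F : ℕ × ℕ → ℝ) (hF : ∀ p, Odd p.1 → F p = 0) (n : ℕ) :
    ∑ p ∈ Finset.HasAntidiagonal.antidiagonal (2 * n), F p =
    ∑ p ∈ Finset.HasAntidiagonal.antidiagonal n, F (2 * p.1, 2 * p.2) := by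
  symm
  refine Finset.sum_of_injOn (fun p : ℕ × ℕ => (2 * p.1, 2 * p.2)) ?_ ?_ ?_ ?_
  · rintro ⟨a, b⟩ _ ⟨c, d⟩ _ h
    simpa using h
  · rintro ⟨a, b⟩ h
    simp only [SetLike.mem_coe, Finset.mem_coe, Finset.HasAntidiagonal.mem_antidiagonal] at h ⊢
    omega
  · rintro ⟨a, b⟩ h h'
    apply hF
    rw [Finset.HasAntidiagonal.mem_antidiagonal] at h
    by_contra ho
    obtain ⟨k, hk⟩ := Nat.not_odd_iff_even.1 ho
    apply h'
    simp only at h hk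
    refine ⟨(k, n - k), ?_, ?_⟩
    · simp only [SetLike.mem_coe, Finset.mem_coe, Finset.HasAntidiagonal.mem_antidiagonal]; omega
    · simp only [Prod.mk.injEq]; omega
  · intro p _; rfl

lemma jm_even {α β : ℝ} (hα : -(1/2) < α) (hβ : -(1/2) < β) (A B : ℝ) (k : ℕ) :
    jm α β A B (2 * k) = ((2 * k).factorial : ℝ) / 4 ^ k * eR α β (A ^ 2) (B ^ 2) k := by
  rw [jm, even_sum, eR, Finset.mul_sum]
  · refine Finset.sum_congr rfl fun p hp => ?_
    rw [Finset.HasAntidiagonal.mem_antidiagonal] at hp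
    subst hp
    obtain ⟨i, j⟩ := p
    simp only
    rw [mom_even hα, mom_even hβ, wt]
    have h := Nat.add_choose_mul_factorial_mul_factorial (2 * i) (2 * j)
    rw [← Nat.choose_symm_add] at h
    rw [mul_add 2 i j, ← h]
    have h1 : (i.factorial:ℝ) ≠ 0 := by exact_mod_cast i.factorial_ne_zero
    have h2 : (j.factorial:ℝ) ≠ 0 := by exact_mod_cast j.factorial_ne_zero
    have h3 := (poch_pos (x := α + 1) (by linarith) i).ne'
    have h4 := (poch_pos (x := β + 1) (by linarith) j).ne'
    push_cast
    rw [pow_mul, pow_mul, pow_add]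
    field_simp
  · intro p hp
    rw [mom_odd' hα hp]; simp

lemma J_odd {α β : ℝ} (hα : -(1/2) < α) (hβ : -(1/2) < β) (A B l : ℝ) {m : ℕ} (hm : Odd m) :
    ∑ p ∈ Finset.HasAntidiagonal.antidiagonal m, gF l 1 p * jm α β A B p.1 = 0 := by
  refine Finset.sum_eq_zero fun p hp => ?_
  rw [Finset.HasAntidiagonal.mem_antidiagonal] at hp
  rw [← hp, Nat.odd_add] at hm
  rcases Nat.even_or_odd p.1 with h | h
  · have : ¬ Even p.2 := fun h' => (Nat.not_odd_iff_even.2 h) (hm.2 h')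
    simp [gF, this]
  · rw [jm_odd hα hβ A B h]; simp

/-- Coefficients for the even terms. -/
noncomputable def dk (l : ℝ) (n k : ℕ) : ℝ :=
  (-1) ^ (n - k) * poch l (2 * k + (n - k)) / (n - k).factorial

lemma dk_succ (l : ℝ) (n k : ℕ) (hk : k < n) :
    dk l n (k + 1) = (k * (k + l) - n * (n + l)) * dk l n k := by
  obtain ⟨j, rfl⟩ := Nat.exists_eq_add_of_lt hk
  unfold dk
  rw [show k + j + 1 - (k + 1) = j by omega, show k + j + 1 - k = j + 1 by omega,
    show 2 * (k + 1) + j = (2 * k + (j + 1)) + 1 by ring, poch_succ, Nat.factorial_succ]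
  have h2 : (j.factorial:ℝ) ≠ 0 := by exact_mod_cast j.factorial_ne_zero
  have h3 : (j:ℝ) + 1 ≠ 0 := by positivity
  push_cast
  field_simp
  ring

lemma J_even {α β : ℝ} (hα : -(1/2) < α) (hβ : -(1/2) < β) (A B l : ℝ) (hl : 0 < l) (n : ℕ) :
    ∑ p ∈ Finset.HasAntidiagonal.antidiagonal (2 * n), gF l 1 p * jm α β A B p.1 =
    (l + 2 * n) / l * ∑ k ∈ Finset.range (n + 1), dk l n k * eR α β (A ^ 2) (B ^ 2) k := by
  rw [even_sum]
  · have := Finset.Nat.sum_antidiagonal_eq_sum_range_succ_mk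
      (fun p : ℕ × ℕ => gF l 1 (2 * p.1, 2 * p.2) * jm α β A B (2 * p.1)) n
    refine this.trans ?_
    rw [Finset.mul_sum]
    refine Finset.sum_congr rfl fun k hk => ?_
    obtain ⟨j, rfl⟩ := Nat.exists_eq_add_of_le (Nat.lt_succ_iff.1 (Finset.mem_range.1 hk))
    simp only
    rw [jm_even hα hβ]
    simp only [dk, gF, cG, Nat.add_sub_cancel_left, even_two_mul, if_true]
    rw [Nat.mul_div_cancel_left _ (by norm_num : 0 < 2)]
    have h1 : ((2*k).factorial:ℝ) ≠ 0 := by exact_mod_cast (2*k).factorial_ne_zero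
    have h2 : (j.factorial:ℝ) ≠ 0 := by exact_mod_cast j.factorial_ne_zero
    rw [pow_mul]
    push_cast
    field_simp
    norm_num
    ring
  · intro p hp
    rw [jm_odd hα hβ A B hp]; simp

end JP
namespace JP

lemma trig_prod {α β : ℝ} (hα : -(1/2) < α) (hβ : -(1/2) < β) (n : ℕ) {θ φ : ℝ}
    (hθ : θ ∈ Ioo (0:ℝ) π) (hφ : φ ∈ Ioo (0:ℝ) π) (hl : 0 < α + β + 1) :
    jacobiTrig α β n θ * jacobiTrig α β n φ =
      Real.Gamma (α + β + 2) / (Real.Gamma (α + 1) * Real.Gamma (β + 1)) *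
      ((α + β + 1 + 2 * n) / (α + β + 1) * ∑ k ∈ Finset.range (n + 1), dk (α + β + 1) n k *
        eR α β ((Real.sin (θ/2) * Real.sin (φ/2)) ^ 2) ((Real.cos (θ/2) * Real.cos (φ/2)) ^ 2) k) := by
  have hc : ∀ x ∈ Ioo (0:ℝ) π, Real.cos x ∈ Ioo (-1:ℝ) 1 := by
    intro x hx
    constructor
    · rw [← Real.cos_pi]
      exact Real.strictAntiOn_cos ⟨hx.1.le, hx.2.le⟩ ⟨Real.pi_pos.le, le_rfl⟩ hx.2
    · rw [← Real.cos_zero]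
      exact Real.strictAntiOn_cos ⟨le_rfl, Real.pi_pos.le⟩ ⟨hx.1.le, hx.2.le⟩ hx.1
  have hx : ∀ x : ℝ, (1 - Real.cos x) / 2 = Real.sin (x/2) ^ 2 := by
    intro x
    have h1 := Real.cos_sq (x/2)
    have h2 := Real.sin_sq_add_cos_sq (x/2)
    rw [show 2 * (x/2) = x by ring] at h1
    linarith
  have hS := S_eq (α := α) (β := β) (by linarith) (by linarith) (Real.sin (θ/2) ^ 2) (Real.sin (φ/2) ^ 2) n
    (dk (α + β + 1) n) (fun k hk => by rw [dk_succ _ _ _ hk]; ring)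
  rw [show (1 - Real.sin (θ/2) ^ 2) * (1 - Real.sin (φ/2) ^ 2) = (Real.cos (θ/2) * Real.cos (φ/2)) ^ 2 by
    rw [mul_pow, Real.cos_sq', Real.cos_sq'], ← mul_pow] at hS
  set S := ∑ k ∈ Finset.range (n + 1), dk (α + β + 1) n k *
        eR α β ((Real.sin (θ/2) * Real.sin (φ/2)) ^ 2) ((Real.cos (θ/2) * Real.cos (φ/2)) ^ 2) k with hSd
  have hd0 : dk (α + β + 1) n 0 = (-1) ^ n * poch (α + β + 1) n / n.factorial := by simp [dk]
  have hP := poch_pos (x := α + 1) (by linarith) n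
  have hQ := poch_pos (x := β + 1) (by linarith) n
  have hL := poch_pos hl n
  have hn : (0:ℝ) < n.factorial := by exact_mod_cast n.factorial_pos
  have hGa := Real.Gamma_pos_of_pos (show 0 < α + 1 by linarith)
  have hGb := Real.Gamma_pos_of_pos (show 0 < β + 1 by linarith)
  have hGl := Real.Gamma_pos_of_pos hl
  have g1 := poch_Gamma (show 0 < α + 1 by linarith) n
  have g2 := poch_Gamma (show 0 < β + 1 by linarith) n
  have g3 := poch_Gamma hl n
  have g4 : Real.Gamma (α + β + 2) = (α + β + 1) * Real.Gamma (α + β + 1) := by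
    rw [← Real.Gamma_add_one hl.ne']; ring_nf
  have hS2 : S * (poch (α + 1) n * poch (β + 1) n) = poch (α + β + 1) n * n.factorial *
      ((Qp α β n).eval (Real.sin (θ/2) ^ 2) * (Qp α β n).eval (Real.sin (φ/2) ^ 2)) := by
    rw [hd0] at hS
    have h1 : ((-1:ℝ) ^ n) * (-1) ^ n = 1 := by rw [← mul_pow]; simp
    have h2 : ((-1:ℝ) ^ n) ≠ 0 := by positivity
    apply mul_left_cancel₀ h2
    calc _ = S * ((-1) ^ n * (poch (α + 1) n * poch (β + 1) n)) := by ring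
      _ = _ := by rw [hS]; field_simp
  have hS3 : S = poch (α + β + 1) n * n.factorial *
      ((Qp α β n).eval (Real.sin (θ/2) ^ 2) * (Qp α β n).eval (Real.sin (φ/2) ^ 2)) /
      (poch (α + 1) n * poch (β + 1) n) := by
    rw [eq_div_iff (by positivity), hS2]
  unfold jacobiTrig
  rw [jacobiP_eq _ _ _ _ (hc θ hθ), jacobiP_eq _ _ _ _ (hc φ hφ), hx, hx, hS3]
  rw [mul_mul_mul_comm, Real.mul_self_sqrt]
  · rw [Real.Gamma_nat_eq_factorial, show (n:ℝ) + α + β + 1 = α + β + 1 + n by ring,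
      show (n:ℝ) + α + 1 = α + 1 + n by ring, show (n:ℝ) + β + 1 = β + 1 + n by ring, g1, g2, g3, g4]
    field_simp
    ring
  · rw [Real.Gamma_nat_eq_factorial, show (n:ℝ) + α + β + 1 = α + β + 1 + n by ring,
      show (n:ℝ) + α + 1 = α + 1 + n by ring, show (n:ℝ) + β + 1 = β + 1 + n by ring, g1, g2, g3]
    have : 0 < 2 * (n:ℝ) + α + β + 1 := by have : (0:ℝ) ≤ n := n.cast_nonneg; linarith
    positivity

end JP

theorem jacobiPoisson_product_formula (α β t θ φ : ℝ) (hα : -(1/2) < α) (hβ : -(1/2) < β)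
    (ht : 0 < t) (hθ : θ ∈ Ioo (0:ℝ) π) (hφ : φ ∈ Ioo (0:ℝ) π) :
    HasSum (fun n : ℕ => Real.exp (-t * ((n:ℝ) + (α + β + 1)/2)) * jacobiTrig α β n θ * jacobiTrig α β n φ)
      (Real.Gamma (α + β + 2) / (Real.Gamma (α + 1) * Real.Gamma (β + 1)) *
        ∫ v, ∫ u, (Real.exp (-t * (α + β + 1)/2) * (1 - Real.exp (-t))) /
          ((1 - Real.exp (-t/2)) ^ 2 + 2 * Real.exp (-t/2) *
            (1 - (u * Real.sin (θ/2) * Real.sin (φ/2) + v * Real.cos (θ/2) * Real.cos (φ/2)))) ^ (α + β + 2)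
          ∂(jacobiPiMeasure α) ∂(jacobiPiMeasure β)) := by
  have hl : 0 < α + β + 1 := by linarith
  have hs0 : 0 ≤ Real.exp (-t/2) := (Real.exp_pos _).le
  have hs1 : Real.exp (-t/2) < 1 := by rw [Real.exp_lt_one_iff]; linarith
  have hss : Real.exp (-t) = Real.exp (-t/2) ^ 2 := by
    rw [← Real.exp_nat_mul]; congr 1; push_cast; ring
  set A := Real.sin (θ/2) * Real.sin (φ/2) with hA
  set B := Real.cos (θ/2) * Real.cos (φ/2) with hB
  have hAB : |A| + |B| ≤ 1 := by
    have h1 := Real.sin_sq_add_cos_sq (θ/2)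
    have h2 := Real.sin_sq_add_cos_sq (φ/2)
    rw [hA, hB, abs_mul, abs_mul]
    rw [← sq_abs (Real.sin _), ← sq_abs (Real.cos _)] at h1 h2
    nlinarith [sq_nonneg (|Real.sin (θ/2)| - |Real.sin (φ/2)|),
      sq_nonneg (|Real.cos (θ/2)| - |Real.cos (φ/2)|)]
  have h := JP.int_hasSum hα hβ hl hAB hs0 hs1
  simp_rw [JP.dbl_int hα hβ] at h
  have hinj : Function.Injective (fun n : ℕ => 2 * n) := fun a b h => by simpa using h
  rw [← hinj.hasSum_iff] at h
  swap
  · intro m hm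
    rw [JP.J_odd hα hβ, zero_mul]
    rw [← Nat.not_even_iff_odd]
    rintro ⟨k, hk⟩
    exact hm ⟨k, by simp; omega⟩
  have h' := h.mul_left (Real.Gamma (α + β + 2) / (Real.Gamma (α + 1) * Real.Gamma (β + 1)) *
    Real.exp (-t * (α + β + 1)/2))
  have e : (fun n : ℕ => Real.exp (-t * ((n:ℝ) + (α + β + 1)/2)) * jacobiTrig α β n θ * jacobiTrig α β n φ)
      = fun n => (Real.Gamma (α + β + 2) / (Real.Gamma (α + 1) * Real.Gamma (β + 1)) *
    Real.exp (-t * (α + β + 1)/2)) * ((fun m => (∑ p ∈ Finset.HasAntidiagonal.antidiagonal m,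
        JP.gF (α + β + 1) 1 p * JP.jm α β A B p.1) * Real.exp (-t/2) ^ m) ∘ fun n => 2 * n) n := by
    funext n
    rw [mul_assoc, JP.trig_prod hα hβ n hθ hφ hl]
    simp only [Function.comp_apply]
    rw [JP.J_even hα hβ _ _ _ hl, ← Real.exp_nat_mul]
    rw [show -t * ((n:ℝ) + (α + β + 1)/2) = -t * (α + β + 1)/2 + ((2 * n : ℕ) : ℝ) * (-t/2) by
      push_cast; ring, Real.exp_add]
    ring
  rw [e]
  convert! h' using 1
  rw [mul_assoc]
  congr 1
  rw [← integral_const_mul]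
  congr 1
  funext v
  rw [← integral_const_mul]
  congr 1
  funext u
  rw [hss, show (1 - Real.exp (-t/2)) ^ 2 + 2 * Real.exp (-t/2) *
            (1 - (u * Real.sin (θ/2) * Real.sin (φ/2) + v * Real.cos (θ/2) * Real.cos (φ/2)))
      = 1 - 2 * Real.exp (-t/2) * (u * A + v * B) + Real.exp (-t/2) ^ 2 by rw [hA, hB]; ring,
    show α + β + 2 = α + β + 1 + 1 by ring]
  ring
end

section
/- Let 0 < σ < 1, α ≥ −1/2, β > −1/2, 0 ≤ a, b < ∞ and j ≥ 0 an integer. Set u_j(θ) = (sin(θ/2))^{aj} (cos(θ/2))^{bj}. Then there exists a constant C, depending only on σ and β (and not on α, a, b or j), such that for every nonnegative measurable function f on (0,π) and every θ ∈ (0,π): u_j(θ) ∫_0^π K_σ^{α+aj, β+bj}(θ,φ) u_j(φ)^{−1} f(φ) dμ_{α+aj, β+bj}(φ) ≤ C (sin(θ/2))^{−(α+1/2)} (cos(θ/2))^{−(β+1/2)} ∫_0^π (sin(φ/2))^{α+1/2} (cos(φ/2))^{β+1/2} f(φ) / |θ−φ|^{1−σ} dφ. -/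
open MeasureTheory Real Set

/-- `z(u,v,θ,φ) = u sin(θ/2) sin(φ/2) + v cos(θ/2) cos(φ/2)`. -/
noncomputable def zAux (u v θ φ : ℝ) : ℝ :=
  u * Real.sin (θ/2) * Real.sin (φ/2) + v * Real.cos (θ/2) * Real.cos (φ/2)

/-- The Jacobi–Poisson kernel `P_t^{α,β}(θ,φ)`. -/
noncomputable def jacobiPoissonKernel (α β t θ φ : ℝ) : ℝ :=
  Real.Gamma (α + β + 2) / (Real.Gamma (α + 1) * Real.Gamma (β + 1)) *
    ∫ v, ∫ u, (Real.exp (-t * (α + β + 1) / 2) * (1 - Real.exp (-t))) /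
      ((1 - Real.exp (-t/2)) ^ 2 + 2 * Real.exp (-t/2) * (1 - zAux u v θ φ)) ^ (α + β + 2)
      ∂(jacobiPiMeasure α) ∂(jacobiPiMeasure β)

/-- The Jacobi fractional integral kernel `K_σ^{α,β}(θ,φ) = (1/Γ(σ)) ∫_0^∞ P_t^{α,β}(θ,φ) t^{σ-1} dt`. -/
noncomputable def jacobiFracKernel (σ α β θ φ : ℝ) : ℝ :=
  (1 / Real.Gamma σ) * ∫ t in Ioi (0:ℝ), jacobiPoissonKernel α β t θ φ * t ^ (σ - 1)

/-- The measure `dμ_{α,β}(θ) = (sin(θ/2))^{2α+1} (cos(θ/2))^{2β+1} dθ` on `(0,π)`. -/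
noncomputable def jacobiMeasure (α β : ℝ) : Measure ℝ :=
  (volume.restrict (Ioo (0:ℝ) π)).withDensity
    (fun θ => ENNReal.ofReal ((Real.sin (θ/2)) ^ (2*α+1) * (Real.cos (θ/2)) ^ (2*β+1)))

lemma jac_gamma_lint (x c : ℝ) (hx : 0 < x) (hc : 0 < c) :
    ∫⁻ r in Ioi (0:ℝ), ENNReal.ofReal (r ^ (x-1) * Real.exp (-(c*r))) =
      ENNReal.ofReal (Real.Gamma x * c ^ (-x)) := by
  have h := Real.integral_rpow_mul_exp_neg_mul_Ioi hx hc
  have hG := Real.Gamma_pos_of_pos hx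
  have hne : ∫ t in Ioi (0:ℝ), t ^ (x-1) * Real.exp (-(c*t)) ≠ 0 := by
    rw [h]; positivity
  rw [← ofReal_integral_eq_lintegral_ofReal (Integrable.of_integral_ne_zero hne), h]
  · rw [one_div, Real.inv_rpow hc.le, ← Real.rpow_neg hc.le, mul_comm]
  · filter_upwards [ae_restrict_mem measurableSet_Ioi] with t ht
    have : 0 < t := ht
    simp only [Pi.zero_apply]; positivity

lemma jac_beta_lint (x p D S : ℝ) (hx : 0 < x) (hp : 0 < p) (hD : 0 < D) (hS : 0 < S) :
    ∫⁻ w in Ioi (0:ℝ), ENNReal.ofReal (w ^ (x-1) * (D + w*S) ^ (-(x+p))) =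
      ENNReal.ofReal (Real.Gamma x * Real.Gamma p / Real.Gamma (x+p) * S ^ (-x) * D ^ (-p)) := by
  have hG := Real.Gamma_pos_of_pos (add_pos hx hp)
  have hGx := Real.Gamma_pos_of_pos hx
  have hGp := Real.Gamma_pos_of_pos hp
  have key : ENNReal.ofReal (Real.Gamma (x+p)) *
      ∫⁻ w in Ioi (0:ℝ), ENNReal.ofReal (w ^ (x-1) * (D + w*S) ^ (-(x+p))) =
      ENNReal.ofReal (Real.Gamma x * S ^ (-x)) * ENNReal.ofReal (Real.Gamma p * D ^ (-p)) := by
    rw [← jac_gamma_lint p D hp hD, ← lintegral_const_mul' _ _ ENNReal.ofReal_ne_top,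
      ← lintegral_const_mul' _ _ ENNReal.ofReal_ne_top]
    calc _ = ∫⁻ w in Ioi (0:ℝ), ∫⁻ r in Ioi (0:ℝ), ENNReal.ofReal
            (w ^ (x-1) * (r ^ (x+p-1) * Real.exp (-((D+w*S)*r)))) := by
          refine setLIntegral_congr_fun measurableSet_Ioi (fun w hw => ?_)
          have hw : 0 < w := hw
          have hc : 0 < D + w*S := by positivity
          simp_rw [ENNReal.ofReal_mul (show 0 ≤ w ^ (x-1) by positivity)]
          rw [lintegral_const_mul' _ _ ENNReal.ofReal_ne_top, jac_gamma_lint _ _ (add_pos hx hp) hc,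
            ENNReal.ofReal_mul hG.le]
          ring
      _ = ∫⁻ r in Ioi (0:ℝ), ∫⁻ w in Ioi (0:ℝ), ENNReal.ofReal
            (w ^ (x-1) * (r ^ (x+p-1) * Real.exp (-((D+w*S)*r)))) := by
          apply lintegral_lintegral_swap
          apply Measurable.aemeasurable
          unfold Function.uncurry
          fun_prop
      _ = _ := by
          refine setLIntegral_congr_fun measurableSet_Ioi (fun r hr => ?_)
          have hr : 0 < r := hr
          have : ∀ w : ℝ, ENNReal.ofReal (w ^ (x-1) * (r ^ (x+p-1) * Real.exp (-((D+w*S)*r)))) =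
              ENNReal.ofReal (r ^ (x+p-1) * Real.exp (-(D*r))) *
                ENNReal.ofReal (w ^ (x-1) * Real.exp (-((r*S)*w))) := by
            intro w
            rw [← ENNReal.ofReal_mul (by positivity)]
            congr 1
            rw [show -((D+w*S)*r) = -(D*r) + -((r*S)*w) by ring, Real.exp_add]
            ring
          simp_rw [this]
          rw [lintegral_const_mul' _ _ ENNReal.ofReal_ne_top, jac_gamma_lint _ _ hx (by positivity),
            ← ENNReal.ofReal_mul (by positivity), ← ENNReal.ofReal_mul (by positivity)]
          congr 1
          rw [Real.mul_rpow hr.le hS.le, show x+p-1 = (p-1) + x by ring, Real.rpow_add hr,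
            Real.rpow_neg hr.le]
          field_simp
  have h1 : ENNReal.ofReal (Real.Gamma (x+p)) ≠ 0 := by simpa using hG
  rw [← ENNReal.mul_right_inj h1 ENNReal.ofReal_ne_top, key, ← ENNReal.ofReal_mul (by positivity),
    ← ENNReal.ofReal_mul (by positivity)]
  congr 1
  field_simp

lemma jac_pi_ae (γ : ℝ) : ∀ᵐ u ∂(jacobiPiMeasure γ), u ∈ Icc (-1:ℝ) 1 := by
  unfold jacobiPiMeasure
  split_ifs with h
  · apply Measure.ae_smul_measure
    rw [ae_add_measure_iff]
    constructor
    · exact (ae_dirac_iff (p := fun x => x ∈ Icc (-1:ℝ) 1) measurableSet_Icc).2 (by norm_num)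
    · exact (ae_dirac_iff (p := fun x => x ∈ Icc (-1:ℝ) 1) measurableSet_Icc).2 (by norm_num)
  · exact (withDensity_absolutelyContinuous _ _).ae_le (ae_restrict_mem measurableSet_Icc)

lemma jac_M (γ p Y S : ℝ) (hγ : -(1/2) ≤ γ) (hp : 0 < p) (hS : 0 < S) (hY : S < Y) :
    ∫⁻ u, ENNReal.ofReal ((Y - u*S) ^ (-(γ+1/2+p))) ∂(jacobiPiMeasure γ) ≤
      ENNReal.ofReal (2 ^ (γ+3/2) * (Real.Gamma (γ+1) / √π) * (Real.Gamma p / Real.Gamma (γ+1/2+p))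
        * S ^ (-(γ+1/2)) * (Y-S) ^ (-p)) := by
  have hD : 0 < Y - S := by linarith
  have hGp := Real.Gamma_pos_of_pos hp
  have hpi : 0 < √π := Real.sqrt_pos.2 Real.pi_pos
  rcases eq_or_lt_of_le hγ with h | h
  · subst h
    have e : (-(1/2) : ℝ) + 1/2 = 0 := by norm_num
    have e3 : (-(1/2) : ℝ) + 3/2 = 1 := by norm_num
    have e2 : (-(1/2) : ℝ) + 1 = 1/2 := by norm_num
    rw [jacobiPiMeasure, if_pos rfl, lintegral_smul_measure, lintegral_add_measure, lintegral_dirac,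
      lintegral_dirac, e, e2, e3, Real.Gamma_one_half_eq, zero_add, neg_zero, Real.rpow_zero,
      Real.rpow_one, div_self hpi.ne', div_self hGp.ne']
    have h1 : (Y - -1*S) ^ (-p) ≤ (Y-S) ^ (-p) :=
      Real.rpow_le_rpow_of_nonpos hD (by linarith) (by linarith)
    rw [one_mul, ← ENNReal.ofReal_add (by have : 0 < Y - -1*S := by linarith
                                          positivity) (by positivity)]
    calc _ ≤ (1:ENNReal) * ENNReal.ofReal ((Y - -1 * S) ^ (-p) + (Y - S) ^ (-p)) := by
          rw [smul_eq_mul]; gcongr; simp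
      _ ≤ _ := by rw [one_mul]; apply ENNReal.ofReal_le_ofReal; linarith
  · have hx : 0 < γ + 1/2 := by linarith
    have hGx := Real.Gamma_pos_of_pos hx
    have hG1 : 0 < Real.Gamma (γ+1) := Real.Gamma_pos_of_pos (by linarith)
    have hGxp := Real.Gamma_pos_of_pos (add_pos hx hp)
    rw [jacobiPiMeasure, if_neg h.ne']
    rw [lintegral_withDensity_eq_lintegral_mul _ (by fun_prop) (by fun_prop)]
    set k : ℝ := Real.Gamma (γ+1) / (√π * Real.Gamma (γ+1/2)) with hk
    have hkpos : 0 < k := by positivity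
    set G : ℝ → ENNReal := (Ioi (0:ℝ)).indicator fun w =>
      ENNReal.ofReal (w ^ (γ+1/2-1) * ((Y-S) + w*S) ^ (-(γ+1/2+p))) with hGdef
    have hGm : Measurable G := by
      apply Measurable.indicator _ measurableSet_Ioi
      fun_prop
    have hGint : ∫⁻ w, G w = ENNReal.ofReal
        (Real.Gamma (γ+1/2) * Real.Gamma p / Real.Gamma (γ+1/2+p) * S ^ (-(γ+1/2)) * (Y-S) ^ (-p)) := by
      rw [hGdef, lintegral_indicator measurableSet_Ioi, jac_beta_lint _ _ _ _ hx hp hD hS]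
    have hpt : ∀ s : ℝ, 0 ≤ s → s < 1 → ∀ u : ℝ, (u = s ∨ u = -s) →
        (1-u^2) ^ (γ-1/2) * (Y-u*S) ^ (-(γ+1/2+p)) ≤
          2 ^ (γ+1/2) * ((1-s) ^ (γ+1/2-1) * ((Y-S) + (1-s)*S) ^ (-(γ+1/2+p))) := by
      intro s hs0 hs1 u hu
      have hus : u^2 = s^2 := by rcases hu with h | h <;> rw [h]; ring
      have hus' : u ≤ s := by rcases hu with h | h <;> linarith
      have h1 : (Y-S) + (1-s)*S = Y - s*S := by ring
      have hb : 0 < Y - s*S := by nlinarith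
      rw [h1, hus, show 1 - s^2 = (1-s)*(1+s) by ring,
        Real.mul_rpow (by linarith) (by linarith), show γ + 1/2 - 1 = γ - 1/2 by ring]
      have h2 : (1+s) ^ (γ-1/2) ≤ 2 ^ (γ+1/2) := by
        calc (1+s) ^ (γ-1/2) ≤ (1+s) ^ (γ+1/2) :=
              Real.rpow_le_rpow_of_exponent_le (by linarith) (by linarith)
          _ ≤ _ := Real.rpow_le_rpow (by linarith) (by linarith) hx.le
      have h3 : (Y-u*S) ^ (-(γ+1/2+p)) ≤ (Y-s*S) ^ (-(γ+1/2+p)) :=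
        Real.rpow_le_rpow_of_nonpos hb (by nlinarith) (by linarith)
      have h4 : 0 ≤ (1-s) ^ (γ-1/2) := Real.rpow_nonneg (by linarith) _
      have h5 : 0 ≤ (Y-u*S) ^ (-(γ+1/2+p)) := Real.rpow_nonneg (by nlinarith) _
      have h6 : 0 ≤ (1+s) ^ (γ-1/2) := Real.rpow_nonneg (by linarith) _
      calc _ ≤ (1-s) ^ (γ-1/2) * 2 ^ (γ+1/2) * (Y-s*S) ^ (-(γ+1/2+p)) := by gcongr
        _ = _ := by ring
    rw [← setLIntegral_congr (Ioo_ae_eq_Icc (a := (-1:ℝ)) (b := 1))]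
    calc _ ≤ ∫⁻ u in Ioo (-1:ℝ) 1, ENNReal.ofReal (k * 2 ^ (γ+1/2)) * (G (1-u) + G (1+u)) := by
          refine setLIntegral_mono (by fun_prop) (fun u hu => ?_)
          simp only [Pi.mul_apply]
          have hle : ∀ s : ℝ, 0 ≤ s → s < 1 → (u = s ∨ u = -s) →
              ENNReal.ofReal (k * (1-u^2) ^ (γ-1/2)) * ENNReal.ofReal ((Y-u*S) ^ (-(γ+1/2+p))) ≤
              ENNReal.ofReal (k * 2 ^ (γ+1/2)) * G (1-s) := by
            intro s h0 h1 hu'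
            have hh := hpt s h0 h1 u hu'
            rw [hGdef, indicator_of_mem (by simpa using h1),
              ← ENNReal.ofReal_mul (mul_nonneg hkpos.le (Real.rpow_nonneg (by nlinarith [hu.1, hu.2]) _)),
              ← ENNReal.ofReal_mul (by positivity)]
            apply ENNReal.ofReal_le_ofReal
            rw [mul_assoc, mul_assoc]
            gcongr
          rcases le_total 0 u with h0 | h0
          · refine (hle u h0 hu.2 (Or.inl rfl)).trans ?_
            gcongr; exact le_self_add
          · refine (hle (-u) (by linarith) (by linarith [hu.1]) (Or.inr (by ring))).trans ?_
            rw [sub_neg_eq_add]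
            gcongr; exact le_add_self
      _ ≤ ∫⁻ u, ENNReal.ofReal (k * 2 ^ (γ+1/2)) * (G (1-u) + G (1+u)) :=
          setLIntegral_le_lintegral _ _
      _ = ENNReal.ofReal (k * 2 ^ (γ+1/2)) * ((∫⁻ w, G w) + ∫⁻ w, G w) := by
          rw [lintegral_const_mul' _ _ ENNReal.ofReal_ne_top, lintegral_add_left (by fun_prop),
            lintegral_sub_left_eq_self G 1, lintegral_add_left_eq_self G 1]
      _ = _ := by
          rw [hGint, ← ENNReal.ofReal_add (by positivity) (by positivity),
            ← ENNReal.ofReal_mul (by positivity)]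
          congr 1
          rw [hk, show γ + 3/2 = (γ+1/2) + 1 by ring, Real.rpow_add_one (by norm_num)]
          generalize Real.Gamma (γ+1/2+p) = g1 at *
          generalize Real.Gamma (γ+1/2) = g2 at *
          generalize (2:ℝ) ^ (γ+1/2) = g3 at *
          generalize S ^ (-(γ+1/2)) = g4 at *
          field_simp
          ring

lemma jac_D (A B R S T : ℝ) (hA : -(1/2) ≤ A) (hB : -(1/2) ≤ B) (hS : 0 < S) (hT : 0 < T)
    (hR : S + T < R) :
    ∫⁻ v, ∫⁻ u, ENNReal.ofReal ((R - u*S - v*T) ^ (-(A+B+2))) ∂(jacobiPiMeasure A)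
      ∂(jacobiPiMeasure B) ≤
      ENNReal.ofReal (2 ^ (A+B+3) / π * (Real.Gamma (A+1) * Real.Gamma (B+1) / Real.Gamma (A+B+2))
        * S ^ (-(A+1/2)) * T ^ (-(B+1/2)) / (R-S-T)) := by
  have hGA : 0 < Real.Gamma (A+1) := Real.Gamma_pos_of_pos (by linarith)
  have hGB : 0 < Real.Gamma (B+1) := Real.Gamma_pos_of_pos (by linarith)
  have hGN : 0 < Real.Gamma (A+B+2) := Real.Gamma_pos_of_pos (by linarith)
  have hGb : 0 < Real.Gamma (B+3/2) := Real.Gamma_pos_of_pos (by linarith)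
  have hpi : 0 < √π := Real.sqrt_pos.2 Real.pi_pos
  have hD : 0 < R - S - T := by linarith
  set k : ℝ := 2 ^ (A+3/2) * (Real.Gamma (A+1) / √π) * (Real.Gamma (B+3/2) / Real.Gamma (A+B+2))
        * S ^ (-(A+1/2)) with hk
  have hkpos : 0 < k := by positivity
  calc _ ≤ ∫⁻ v, ENNReal.ofReal k * ENNReal.ofReal ((R - S - v*T) ^ (-(B+1/2+1)))
        ∂(jacobiPiMeasure B) := by
        refine lintegral_mono_ae ?_
        filter_upwards [jac_pi_ae B] with v hv
        have h := jac_M A (B+3/2) (R - v*T) S hA (by linarith) hS (by nlinarith [hv.2])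
        rw [show A + 1/2 + (B+3/2) = A+B+2 by ring] at h
        rw [← ENNReal.ofReal_mul hkpos.le]
        convert h using 4
        · ring
        · ring
        · ring
    _ ≤ ENNReal.ofReal k * ENNReal.ofReal (2 ^ (B+3/2) * (Real.Gamma (B+1) / √π) *
          (Real.Gamma 1 / Real.Gamma (B+1/2+1)) * T ^ (-(B+1/2)) * (R-S-T) ^ (-(1:ℝ))) := by
        rw [lintegral_const_mul' _ _ ENNReal.ofReal_ne_top]
        gcongr
        exact jac_M B 1 (R-S) T hB one_pos hT (by linarith)
    _ = _ := by
        rw [← ENNReal.ofReal_mul hkpos.le]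
        congr 1
        rw [hk, show B + 1/2 + 1 = B + 3/2 by ring, Real.Gamma_one, Real.rpow_neg_one,
          show A + B + 3 = (A+3/2) + (B+3/2) by ring, Real.rpow_add two_pos (A+3/2) (B+3/2)]
        have hpp : π = √π * √π := (Real.mul_self_sqrt Real.pi_pos.le).symm
        generalize √π = s at *
        rw [hpp]
        generalize Real.Gamma (B+3/2) = g1 at *
        generalize Real.Gamma (A+B+2) = g2 at *
        generalize Real.Gamma (A+1) = g5 at *
        generalize Real.Gamma (B+1) = g6 at *
        generalize (2:ℝ) ^ (A+3/2) = g3 at *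
        generalize (2:ℝ) ^ (B+3/2) = g7 at *
        generalize S ^ (-(A+1/2)) = g4 at *
        generalize T ^ (-(B+1/2)) = g8 at *
        field_simp

lemma jac_P (A B t θ φ κ L R S T : ℝ) (hA : -(1/2) ≤ A) (hB : -(1/2) ≤ B) (ht : 0 < t)
    (hSd : S = Real.sin (θ/2) * Real.sin (φ/2)) (hTd : T = Real.cos (θ/2) * Real.cos (φ/2))
    (hS : 0 < S) (hT : 0 < T) (hST : S + T ≤ 1)
    (hκ : 0 < κ) (hL : 0 < L) (hR : L * (S + T) < R)
    (hz : ∀ z ∈ Icc (-1:ℝ) 1, κ * (R - L*z) ≤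
      (1 - Real.exp (-t/2)) ^ 2 + 2 * Real.exp (-t/2) * (1 - z)) :
    |jacobiPoissonKernel A B t θ φ| ≤
      Real.exp (-t * (A + B + 1) / 2) * (1 - Real.exp (-t)) * κ ^ (-(A+B+2)) * (2 ^ (A+B+3) / π) *
       L ^ (-(A+B+1)) * (S ^ (-(A+1/2)) * T ^ (-(B+1/2))) / (R - L * (S+T)) := by
  have hGA : 0 < Real.Gamma (A+1) := Real.Gamma_pos_of_pos (by linarith)
  have hGB : 0 < Real.Gamma (B+1) := Real.Gamma_pos_of_pos (by linarith)
  have hGN : 0 < Real.Gamma (A+B+2) := Real.Gamma_pos_of_pos (by linarith)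
  have hD : 0 < R - L * (S+T) := by linarith
  have het : 0 < 1 - Real.exp (-t) := by
    have : Real.exp (-t) < 1 := Real.exp_lt_one_iff.2 (by linarith)
    linarith
  set E : ℝ := Real.exp (-t * (A + B + 1) / 2) * (1 - Real.exp (-t)) with hE
  have hEpos : 0 < E := by positivity
  set c : ℝ := Real.Gamma (A + B + 2) / (Real.Gamma (A + 1) * Real.Gamma (B + 1)) with hc
  have hcpos : 0 < c := by positivity
  rw [← ENNReal.ofReal_le_ofReal_iff (by positivity), ← Real.enorm_eq_ofReal_abs]
  have hk : 0 < E * κ ^ (-(A+B+2)) := by positivity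
  calc ‖jacobiPoissonKernel A B t θ φ‖ₑ
      ≤ ENNReal.ofReal c * ∫⁻ v, ∫⁻ u, ENNReal.ofReal (E * κ ^ (-(A+B+2))) *
          ENNReal.ofReal ((R - u*(L*S) - v*(L*T)) ^ (-(A+B+2))) ∂(jacobiPiMeasure A)
            ∂(jacobiPiMeasure B) := by
        unfold jacobiPoissonKernel
        rw [enorm_mul, Real.enorm_of_nonneg hcpos.le]
        gcongr
        refine (enorm_integral_le_lintegral_enorm _).trans ?_
        refine lintegral_mono_ae ?_
        filter_upwards [jac_pi_ae B] with v hv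
        refine (enorm_integral_le_lintegral_enorm _).trans ?_
        refine lintegral_mono_ae ?_
        filter_upwards [jac_pi_ae A] with u hu
        have hzz : zAux u v θ φ = u*S + v*T := by rw [zAux, hSd, hTd]; ring
        have h1 := hz (u*S+v*T) ⟨by nlinarith [hu.1, hv.1], by nlinarith [hu.2, hv.2]⟩
        have h0 : 0 < R - L*(u*S+v*T) := by
          have : u*S+v*T ≤ S+T := by nlinarith [hu.2, hv.2]
          nlinarith
        rw [hzz, ← ENNReal.ofReal_mul hk.le, show R - u*(L*S) - v*(L*T) = R - L*(u*S+v*T) by ring]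
        have h2 : 0 < (1 - Real.exp (-t/2)) ^ 2 + 2 * Real.exp (-t/2) * (1 - (u*S+v*T)) :=
          (mul_pos hκ h0).trans_le h1
        rw [Real.enorm_of_nonneg (by positivity)]
        apply ENNReal.ofReal_le_ofReal
        rw [div_eq_mul_inv, ← Real.rpow_neg h2.le, mul_assoc E, ← Real.mul_rpow hκ.le h0.le]
        have := Real.rpow_le_rpow_of_nonpos (mul_pos hκ h0) h1 (show -(A+B+2) ≤ 0 by linarith)
        gcongr
    _ ≤ ENNReal.ofReal c * (ENNReal.ofReal (E * κ ^ (-(A+B+2))) *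
          ENNReal.ofReal (2 ^ (A+B+3) / π * (Real.Gamma (A+1) * Real.Gamma (B+1) / Real.Gamma (A+B+2))
        * (L*S) ^ (-(A+1/2)) * (L*T) ^ (-(B+1/2)) / (R-L*S-L*T))) := by
        simp_rw [lintegral_const_mul' _ _ ENNReal.ofReal_ne_top]
        gcongr
        exact jac_D A B R (L*S) (L*T) hA hB (by positivity) (by positivity) (by linarith)
    _ = _ := by
        rw [← ENNReal.ofReal_mul hk.le, ← ENNReal.ofReal_mul hcpos.le]
        congr 1
        rw [Real.mul_rpow hL.le hS.le, Real.mul_rpow hL.le hT.le,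
          show -(A+B+1) = -(A+1/2) + -(B+1/2) by ring, Real.rpow_add hL,
          show R - L*S - L*T = R - L*(S+T) by ring, hc]
        clear_value E
        generalize Real.Gamma (A+B+2) = g2 at *
        generalize Real.Gamma (A+1) = g5 at *
        generalize Real.Gamma (B+1) = g6 at *
        generalize (2:ℝ) ^ (A+B+3) = g3 at *
        generalize κ ^ (-(A+B+2)) = g7 at *
        generalize S ^ (-(A+1/2)) = g4 at *
        generalize T ^ (-(B+1/2)) = g8 at *
        generalize L ^ (-(A+1/2)) = g9 at *
        generalize L ^ (-(B+1/2)) = g10 at *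
        generalize R - L*(S+T) = D at *
        field_simp

/-- small times -/
lemma jac_P_small (A B t θ φ S T : ℝ) (hA : -(1/2) ≤ A) (hB : -(1/2) ≤ B) (ht : 0 < t) (ht4 : t ≤ 4)
    (hSd : S = Real.sin (θ/2) * Real.sin (φ/2)) (hTd : T = Real.cos (θ/2) * Real.cos (φ/2))
    (hS : 0 < S) (hT : 0 < T) (hd : |θ - φ| < π) :
    |jacobiPoissonKernel A B t θ φ| ≤
      360 / π * (S ^ (-(A+1/2)) * T ^ (-(B+1/2))) * (t / (t^2 + |θ - φ|^2)) := by
  have hc : S + T = Real.cos ((θ-φ)/2) := by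
    rw [hSd, hTd, sub_div, Real.cos_sub]; ring
  have hST : S + T ≤ 1 := by rw [hc]; exact Real.cos_le_one _
  set q : ℝ := Real.exp (-t/2) with hq
  have hq0 : 0 < q := Real.exp_pos _
  have hq1 : q < 1 := Real.exp_lt_one_iff.2 (by linarith)
  have hqq : Real.exp (-t) = q^2 := by rw [hq, ← Real.exp_nat_mul]; congr 1; push_cast; ring
  have hmain := jac_P A B t θ φ 1 (2*q) (1+q^2) S T hA hB ht hSd hTd hS hT hST one_pos (by positivity)
    (by nlinarith [sq_pos_of_pos (sub_pos.2 hq1)]) (fun z _ => by nlinarith)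
  have hcos : S + T ≤ 1 - |θ-φ|^2/20 := by
    rw [hc]
    have := Real.cos_le_one_sub_mul_cos_sq (x := (θ-φ)/2) (by
      rw [abs_div, abs_of_pos (two_pos : (0:ℝ) < 2)]; linarith [Real.pi_pos])
    rw [sq_abs]
    have hp : (1:ℝ)/10 ≤ 1/π^2 := by
      apply one_div_le_one_div_of_le (by positivity)
      nlinarith [Real.pi_lt_d2, Real.pi_pos]
    have : 2/π^2 * ((θ-φ)/2)^2 = 1/π^2 * ((θ-φ)^2/2) := by ring
    nlinarith [sq_nonneg (θ-φ)]
  have hqlow : 1/9 ≤ q := by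
    have h1 : Real.exp (-2) ≤ q := Real.exp_le_exp.2 (by linarith)
    have h2 : Real.exp (-2) = (Real.exp 1)⁻¹ ^ 2 := by
      rw [← Real.exp_neg, ← Real.exp_nat_mul]; norm_num
    have h3 : (1:ℝ)/3 ≤ (Real.exp 1)⁻¹ := by
      rw [← one_div]
      exact one_div_le_one_div_of_le (Real.exp_pos 1) (by linarith [Real.exp_one_lt_d9])
    nlinarith
  have hqup : t/6 ≤ 1 - q := by
    have h1 : t/2 + 1 ≤ Real.exp (t/2) := Real.add_one_le_exp _
    have h2 : q * Real.exp (t/2) = 1 := by rw [hq, ← Real.exp_add]; simp; ring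
    nlinarith
  have hq2 : 1 - q^2 ≤ t := by
    have := Real.add_one_le_exp (-t)
    rw [← hqq]; linarith
  have hden : (t^2 + |θ-φ|^2)/90 ≤ 1 + q^2 - 2*q*(S+T) := by
    have : (1-q)^2 ≥ (t/6)^2 := by gcongr
    have h0 : 0 ≤ |θ-φ|^2 := by positivity
    have : 2*q*(1-(S+T)) ≥ 2*(1/9)*(|θ-φ|^2/20) := by
      have : |θ-φ|^2/20 ≤ 1-(S+T) := by linarith
      gcongr
    nlinarith [sq_nonneg t]
  have hdp : 0 < t^2 + |θ-φ|^2 := by positivity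
  refine hmain.trans ?_
  rw [Real.one_rpow, hqq, Real.mul_rpow (by norm_num) hq0.le,
    show Real.exp (-t*(A+B+1)/2) = q ^ (A+B+1) by rw [hq, ← Real.exp_mul]; congr 1; ring,
    show A+B+3 = (A+B+1)+2 by ring, Real.rpow_add two_pos, Real.rpow_neg two_pos.le,
    Real.rpow_neg hq0.le]
  have hqp : 0 < q ^ (A+B+1) := by positivity
  have h2p : (0:ℝ) < 2 ^ (A+B+1) := by positivity
  have hW : 0 < S ^ (-(A+1/2)) * T ^ (-(B+1/2)) := by positivity
  have h22 : (2:ℝ)^(2:ℝ) = 4 := by norm_num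
  rw [h22]
  generalize q ^ (A+B+1) = x at *
  generalize (2:ℝ) ^ (A+B+1) = y at *
  generalize S ^ (-(A+1/2)) * T ^ (-(B+1/2)) = W at *
  have hden0 : 0 < 1 + q^2 - 2*q*(S+T) := lt_of_lt_of_le (by positivity) hden
  calc _ = 4/π * W * ((1-q^2)/(1 + q^2 - 2*q*(S+T))) := by field_simp
    _ ≤ 4/π * W * (t/((t^2 + |θ-φ|^2)/90)) := by gcongr
    _ = _ := by field_simp; norm_num

/-- large times -/
lemma jac_P_large (A B m t θ φ S T : ℝ) (hA : -(1/2) ≤ A) (hB : -(1/2) ≤ B) (hm : m ≤ A + B + 1)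
    (ht : 4 ≤ t)
    (hSd : S = Real.sin (θ/2) * Real.sin (φ/2)) (hTd : T = Real.cos (θ/2) * Real.cos (φ/2))
    (hS : 0 < S) (hT : 0 < T) :
    |jacobiPoissonKernel A B t θ φ| ≤
      36 / π * (S ^ (-(A+1/2)) * T ^ (-(B+1/2))) * ((9/2)^m * Real.exp (-(m/2*t))) := by
  have hc : S + T = Real.cos ((θ-φ)/2) := by
    rw [hSd, hTd, sub_div, Real.cos_sub]; ring
  have hST : S + T ≤ 1 := by rw [hc]; exact Real.cos_le_one _
  set q : ℝ := Real.exp (-t/2) with hq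
  have hq0 : 0 < q := Real.exp_pos _
  have hqq : Real.exp (-t) = q^2 := by rw [hq, ← Real.exp_nat_mul]; congr 1; push_cast; ring
  have hqup : q ≤ 2/9 := by
    have h1 : q ≤ Real.exp (-2) := Real.exp_le_exp.2 (by linarith)
    have h2 : Real.exp (-2) = (Real.exp 1)⁻¹ ^ 2 := by
      rw [← Real.exp_neg, ← Real.exp_nat_mul]; norm_num
    have h3 : (Real.exp 1)⁻¹ ≤ 10/27 := by
      rw [← one_div, show (10:ℝ)/27 = 1/2.7 by norm_num]
      exact one_div_le_one_div_of_le (by norm_num) (by linarith [Real.exp_one_gt_d9])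
    have h4 : 0 < (Real.exp 1)⁻¹ := by positivity
    nlinarith
  have hmain := jac_P A B t θ φ (4/9) 1 (5/4) S T hA hB (by linarith) hSd hTd hS hT hST (by norm_num) one_pos
    (by linarith) (fun z hz => by nlinarith [hz.1, hz.2])
  refine hmain.trans ?_
  have hW : 0 < S ^ (-(A+1/2)) * T ^ (-(B+1/2)) := by positivity
  have e1 : Real.exp (-t*(A+B+1)/2) = q ^ (A+B+1) := by rw [hq, ← Real.exp_mul]; congr 1; ring
  have e2 : Real.exp (-(m/2*t)) = q ^ m := by rw [hq, ← Real.exp_mul]; congr 1; ring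
  have e3 : ((4:ℝ)/9) ^ (-(A+B+2)) = (9/4) ^ (A+B+1) * (9/4) := by
    rw [Real.rpow_neg (by norm_num), ← Real.inv_rpow (by norm_num), ← Real.rpow_add_one (by norm_num)]
    congr 1 <;> ring
  have e4 : (2:ℝ) ^ (A+B+3) = 2 ^ (A+B+1) * 4 := by
    rw [show A+B+3 = (A+B+1)+2 by ring, Real.rpow_add two_pos]; norm_num
  have e5 : q ^ (A+B+1) * (9/4) ^ (A+B+1) * 2 ^ (A+B+1) = (9/2*q) ^ (A+B+1) := by
    rw [← Real.mul_rpow hq0.le (by norm_num), ← Real.mul_rpow (by positivity) (by norm_num)]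
    congr 1; ring
  have e6 : (9/2*q) ^ (A+B+1) ≤ (9/2*q) ^ m :=
    Real.rpow_le_rpow_of_exponent_ge (by positivity) (by linarith) hm
  rw [Real.one_rpow, e1, e2, e3, e4, ← Real.mul_rpow (by norm_num) hq0.le, hqq]
  have hx : 0 ≤ (9/2*q) ^ (A+B+1) := by positivity
  calc _ = 9/π * (S ^ (-(A+1/2)) * T ^ (-(B+1/2))) * ((q ^ (A+B+1) * (9/4) ^ (A+B+1) * 2 ^ (A+B+1))
          * ((1-q^2)/(5/4 - (S+T)))) := by
        rw [one_mul]; ring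
    _ ≤ 9/π * (S ^ (-(A+1/2)) * T ^ (-(B+1/2))) * ((9/2*q) ^ m * (1/(1/4))) := by
        rw [e5]
        have : (1-q^2)/(5/4 - (S+T)) ≤ 1/(1/4) := by
          apply div_le_div₀ <;> nlinarith
        have h7 : 0 ≤ (1-q^2)/(5/4 - (S+T)) := div_nonneg (by nlinarith) (by linarith)
        gcongr
    _ = _ := by ring

lemma jac_time (σ d : ℝ) (hσ0 : 0 < σ) (hσ1 : σ < 1) (hd : 0 < d) :
    ∫⁻ t in Ioi (0:ℝ), ENNReal.ofReal (t / (t^2+d^2) * t ^ (σ-1)) ≤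
      ENNReal.ofReal ((1/σ + 1/(1-σ)) * d ^ (σ-1)) := by
  have h1σ : 0 < 1 - σ := by linarith
  rw [← Ioc_union_Ioi_eq_Ioi hd.le]
  refine (lintegral_union_le _ _ _).trans ?_
  have hA : ∫⁻ t in Ioc (0:ℝ) d, ENNReal.ofReal (t / (t^2+d^2) * t ^ (σ-1)) ≤
      ENNReal.ofReal (1/σ * d ^ (σ-1)) := by
    calc _ ≤ ∫⁻ t in Ioc (0:ℝ) d, ENNReal.ofReal (d⁻¹ * t ^ (σ-1)) := by
          refine setLIntegral_mono (by fun_prop) (fun t ht => ?_)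
          have h0 : 0 < t := ht.1
          apply ENNReal.ofReal_le_ofReal
          gcongr
          rw [div_le_iff₀ (by positivity), inv_mul_eq_div, le_div_iff₀ hd]
          nlinarith [sq_nonneg (t-d)]
      _ = _ := by
          have hi := intervalIntegral.intervalIntegrable_rpow' (a := 0) (b := d) (r := σ-1) (by linarith)
          rw [intervalIntegrable_iff_integrableOn_Ioc_of_le hd.le] at hi
          rw [← ofReal_integral_eq_lintegral_ofReal (hi.const_mul _)]
          · congr 1
            rw [integral_const_mul, ← intervalIntegral.integral_of_le hd.le,
              integral_rpow (Or.inl (by linarith)), Real.zero_rpow (by linarith),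
              Real.rpow_add_one hd.ne', sub_zero, sub_add_cancel]
            field_simp
          · filter_upwards [ae_restrict_mem measurableSet_Ioc] with t ht
            have h0 : 0 < t := ht.1
            simp only [Pi.zero_apply]; positivity
  have hB : ∫⁻ t in Ioi d, ENNReal.ofReal (t / (t^2+d^2) * t ^ (σ-1)) ≤
      ENNReal.ofReal (1/(1-σ) * d ^ (σ-1)) := by
    calc _ ≤ ∫⁻ t in Ioi d, ENNReal.ofReal (t ^ (σ-2)) := by
          refine setLIntegral_mono (by fun_prop) (fun t ht => ?_)
          have h0 : 0 < t := hd.trans ht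
          apply ENNReal.ofReal_le_ofReal
          rw [show σ - 1 = σ - 2 + 1 by ring, Real.rpow_add_one h0.ne', mul_comm, mul_assoc]
          apply mul_le_of_le_one_right (by positivity)
          rw [mul_div_assoc', div_le_one (by positivity)]
          nlinarith [sq_nonneg d]
      _ = _ := by
          rw [← ofReal_integral_eq_lintegral_ofReal (integrableOn_Ioi_rpow_of_lt (by linarith) hd),
            integral_Ioi_rpow_of_lt (by linarith) hd]
          · congr 1
            rw [show σ - 2 + 1 = σ - 1 by ring, ← neg_sub 1 σ]
            field_simp
          · filter_upwards [ae_restrict_mem measurableSet_Ioi] with t ht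
            have h0 : 0 < t := hd.trans ht
            simp only [Pi.zero_apply]; positivity
  calc _ ≤ _ := add_le_add hA hB
    _ = _ := by
      rw [← ENNReal.ofReal_add (by positivity) (by positivity)]
      congr 1; ring

lemma jac_K (σ m A B θ φ S T : ℝ) (hσ0 : 0 < σ) (hσ1 : σ < 1) (hm0 : 0 < m)
    (hA : -(1/2) ≤ A) (hB : -(1/2) ≤ B) (hm : m ≤ A + B + 1)
    (hSd : S = Real.sin (θ/2) * Real.sin (φ/2)) (hTd : T = Real.cos (θ/2) * Real.cos (φ/2))
    (hS : 0 < S) (hT : 0 < T) (hd0 : 0 < |θ - φ|) (hd : |θ - φ| < π) :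
    jacobiFracKernel σ A B θ φ ≤
      (1 / Real.Gamma σ * (360 / π * (1/σ + 1/(1-σ)) +
        36 / π * (9/2)^m * (Real.Gamma σ * (m/2) ^ (-σ)) * π ^ (1-σ))) *
      (S ^ (-(A+1/2)) * T ^ (-(B+1/2))) * |θ - φ| ^ (σ-1) := by
  have h1σ : 0 < 1 - σ := by linarith
  have hG := Real.Gamma_pos_of_pos hσ0
  set d := |θ - φ| with hdd
  set W := S ^ (-(A+1/2)) * T ^ (-(B+1/2)) with hWd
  have hW : 0 < W := by positivity
  have key : ∫ t in Ioi (0:ℝ), jacobiPoissonKernel A B t θ φ * t ^ (σ - 1) ≤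
      W * ((360 / π * (1/σ + 1/(1-σ)) +
        36 / π * (9/2)^m * (Real.Gamma σ * (m/2) ^ (-σ)) * π ^ (1-σ)) * d ^ (σ-1)) := by
    rw [← ENNReal.ofReal_le_ofReal_iff (by positivity)]
    refine (Real.ofReal_le_enorm _).trans ((enorm_integral_le_lintegral_enorm _).trans ?_)
    calc _ ≤ ∫⁻ t in Ioi (0:ℝ), (ENNReal.ofReal (360 / π * W) *
            ENNReal.ofReal (t / (t^2+d^2) * t ^ (σ-1)) +
          ENNReal.ofReal (36 / π * W * (9/2)^m) *
            ENNReal.ofReal (t ^ (σ-1) * Real.exp (-(m/2*t)))) := by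
          refine setLIntegral_mono (by fun_prop) (fun t ht => ?_)
          have h0 : 0 < t := ht
          rw [Real.enorm_eq_ofReal_abs, abs_mul, abs_of_pos (Real.rpow_pos_of_pos h0 _)]
          rcases le_total t 4 with h4 | h4
          · refine le_trans ?_ le_self_add
            rw [← ENNReal.ofReal_mul (by positivity), ← mul_assoc]
            apply ENNReal.ofReal_le_ofReal
            gcongr
            exact jac_P_small A B t θ φ S T hA hB h0 h4 hSd hTd hS hT hd
          · refine le_trans ?_ le_add_self
            rw [← ENNReal.ofReal_mul (by positivity)]
            apply ENNReal.ofReal_le_ofReal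
            have := jac_P_large A B m t θ φ S T hA hB hm h4 hSd hTd hS hT
            calc _ ≤ (36 / π * W * ((9/2)^m * Real.exp (-(m/2*t)))) * t ^ (σ-1) := by gcongr
              _ = _ := by ring
      _ ≤ ENNReal.ofReal (360 / π * W) * ENNReal.ofReal ((1/σ + 1/(1-σ)) * d ^ (σ-1)) +
          ENNReal.ofReal (36 / π * W * (9/2)^m) * ENNReal.ofReal (Real.Gamma σ * (m/2) ^ (-σ)) := by
          rw [lintegral_add_left (by fun_prop), lintegral_const_mul' _ _ ENNReal.ofReal_ne_top,
            lintegral_const_mul' _ _ ENNReal.ofReal_ne_top, jac_gamma_lint σ (m/2) hσ0 (by positivity)]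
          gcongr
          exact jac_time σ d hσ0 hσ1 hd0
      _ ≤ _ := by
          rw [← ENNReal.ofReal_mul (by positivity), ← ENNReal.ofReal_mul (by positivity),
            ← ENNReal.ofReal_add (by positivity) (by positivity)]
          apply ENNReal.ofReal_le_ofReal
          have h1 : 1 ≤ π ^ (1-σ) * d ^ (σ-1) := by
            rw [show σ - 1 = -(1-σ) by ring, Real.rpow_neg hd0.le, ← div_eq_mul_inv,
              one_le_div (by positivity)]
            exact Real.rpow_le_rpow hd0.le hd.le h1σ.le
          have h2 : 0 ≤ 36 / π * W * (9/2)^m * (Real.Gamma σ * (m/2) ^ (-σ)) := by positivity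
          nlinarith [mul_le_mul_of_nonneg_left h1 h2]
  unfold jacobiFracKernel
  calc _ ≤ 1 / Real.Gamma σ * (W * ((360 / π * (1/σ + 1/(1-σ)) +
        36 / π * (9/2)^m * (Real.Gamma σ * (m/2) ^ (-σ)) * π ^ (1-σ)) * d ^ (σ-1))) := by gcongr
    _ = _ := by ring

/-- Pointwise domination of the twisted Jacobi fractional integral by the Euclidean
fractional integral: with `u_j(θ) = (sin(θ/2))^{aj}(cos(θ/2))^{bj}`, for every
nonnegative `f` and `θ ∈ (0,π)`,
`u_j(θ) ∫_0^π K_σ^{α+aj,β+bj}(θ,φ) u_j(φ)^{-1} f(φ) dμ_{α+aj,β+bj}(φ)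
  ≤ C (sin(θ/2))^{-(α+1/2)} (cos(θ/2))^{-(β+1/2)}
      ∫_0^π (sin(φ/2))^{α+1/2} (cos(φ/2))^{β+1/2} f(φ) |θ-φ|^{σ-1} dφ`,
with `C` depending only on `σ` and `β`. -/
theorem jacobi_fracIntegral_pointwise_domination (σ β : ℝ) (hσ0 : 0 < σ) (hσ1 : σ < 1)
    (hβ : -(1/2) < β) :
    ∃ C : ℝ, 0 < C ∧ ∀ α : ℝ, -(1/2) ≤ α → ∀ a b : ℝ, 0 ≤ a → 0 ≤ b → ∀ j : ℕ,
      ∀ f : ℝ → ℝ, Measurable f → (∀ x, 0 ≤ f x) → ∀ θ ∈ Ioo (0:ℝ) π,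
      ENNReal.ofReal ((Real.sin (θ/2)) ^ (a*j) * (Real.cos (θ/2)) ^ (b*j)) *
          ∫⁻ φ, ENNReal.ofReal (jacobiFracKernel σ (α + a*j) (β + b*j) θ φ) *
            (ENNReal.ofReal ((Real.sin (φ/2)) ^ (a*j) * (Real.cos (φ/2)) ^ (b*j)))⁻¹ *
            ENNReal.ofReal (f φ) ∂(jacobiMeasure (α + a*j) (β + b*j)) ≤
        ENNReal.ofReal (C * (Real.sin (θ/2)) ^ (-(α + 1/2)) * (Real.cos (θ/2)) ^ (-(β + 1/2))) *
          ∫⁻ φ in Ioo (0:ℝ) π,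
            ENNReal.ofReal ((Real.sin (φ/2)) ^ (α + 1/2) * (Real.cos (φ/2)) ^ (β + 1/2) * f φ) *
              ENNReal.ofReal |θ - φ| ^ (σ - 1) := by

  have h1σ : 0 < 1 - σ := by linarith
  have hG := Real.Gamma_pos_of_pos hσ0
  have hm0 : 0 < β + 1/2 := by linarith
  refine ⟨1 / Real.Gamma σ * (360 / π * (1/σ + 1/(1-σ)) +
        36 / π * (9/2)^(β+1/2) * (Real.Gamma σ * ((β+1/2)/2) ^ (-σ)) * π ^ (1-σ)),
        by positivity, ?_⟩
  intro α hα a b ha hb j f hf hf0 θ hθ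
  set C := 1 / Real.Gamma σ * (360 / π * (1/σ + 1/(1-σ)) +
        36 / π * (9/2)^(β+1/2) * (Real.Gamma σ * ((β+1/2)/2) ^ (-σ)) * π ^ (1-σ)) with hC
  have hCpos : 0 < C := by positivity
  have haj : 0 ≤ a * j := by positivity
  have hbj : 0 ≤ b * j := by positivity
  generalize a * j = x at *
  generalize b * j = y at *
  have hs : 0 < Real.sin (θ/2) := Real.sin_pos_of_pos_of_lt_pi (by linarith [hθ.1]) (by linarith [hθ.1, hθ.2])
  have hc : 0 < Real.cos (θ/2) := Real.cos_pos_of_mem_Ioo ⟨by linarith [hθ.1, Real.pi_pos], by linarith [hθ.2]⟩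
  have hmeas : Measurable fun θ : ℝ => ENNReal.ofReal
      ((Real.sin (θ/2)) ^ (2*(α+x)+1) * (Real.cos (θ/2)) ^ (2*(β+y)+1)) := by fun_prop
  refine (mul_le_mul_right (lintegral_withDensity_le_lintegral_mul _ hmeas _) _).trans ?_
  rw [← lintegral_const_mul' _ _ ENNReal.ofReal_ne_top,
    ← lintegral_const_mul' _ _ ENNReal.ofReal_ne_top]
  refine lintegral_mono_ae ?_
  have hne : ∀ᵐ φ ∂(volume.restrict (Ioo (0:ℝ) π)), φ ≠ θ :=
    ae_restrict_of_ae (Measure.ae_ne volume θ)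
  filter_upwards [ae_restrict_mem measurableSet_Ioo, hne] with φ hφ hφθ
  have hs' : 0 < Real.sin (φ/2) := Real.sin_pos_of_pos_of_lt_pi (by linarith [hφ.1]) (by linarith [hφ.1, hφ.2])
  have hc' : 0 < Real.cos (φ/2) := Real.cos_pos_of_mem_Ioo ⟨by linarith [hφ.1, Real.pi_pos], by linarith [hφ.2]⟩
  have hd0 : 0 < |θ - φ| := abs_pos.2 (sub_ne_zero.2 hφθ.symm)
  have hd : |θ - φ| < π := by rw [abs_lt]; constructor <;> linarith [hθ.1, hθ.2, hφ.1, hφ.2]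
  have hK := jac_K σ (β+1/2) (α+x) (β+y) θ φ _ _ hσ0 hσ1 hm0 (by linarith) (by linarith) (by linarith)
    rfl rfl (by positivity) (by positivity) hd0 hd
  rw [← hC] at hK
  have hf0' := hf0 φ
  simp only [Pi.mul_apply]
  rw [ENNReal.ofReal_rpow_of_pos hd0, ← ENNReal.ofReal_inv_of_pos (by positivity)]
  set K := jacobiFracKernel σ (α+x) (β+y) θ φ
  set d := |θ - φ|
  calc _ ≤ ENNReal.ofReal (Real.sin (θ/2) ^ x * Real.cos (θ/2) ^ y) *
        (ENNReal.ofReal (Real.sin (φ/2) ^ (2*(α+x)+1) * Real.cos (φ/2) ^ (2*(β+y)+1)) *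
        (ENNReal.ofReal (C * ((Real.sin (θ/2) * Real.sin (φ/2)) ^ (-(α+x+1/2)) *
          (Real.cos (θ/2) * Real.cos (φ/2)) ^ (-(β+y+1/2))) * d ^ (σ-1)) *
          ENNReal.ofReal (Real.sin (φ/2) ^ x * Real.cos (φ/2) ^ y)⁻¹ * ENNReal.ofReal (f φ))) := by
        gcongr
    _ = _ := by
      rw [← ENNReal.ofReal_mul (by positivity), ← ENNReal.ofReal_mul (by positivity),
        ← ENNReal.ofReal_mul (by positivity), ← ENNReal.ofReal_mul (by positivity),
        ← ENNReal.ofReal_mul (by positivity), ← ENNReal.ofReal_mul (by positivity)]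
      congr 1
      have aux : ∀ p q g r : ℝ, 0 < p → 0 < q →
          p ^ r * q ^ (2*(g+r)+1) * (p*q) ^ (-(g+r+1/2)) * (q ^ r)⁻¹ = p ^ (-(g+1/2)) * q ^ (g+1/2) := by
        intro p q g r hp hq
        rw [Real.mul_rpow hp.le hq.le, ← Real.rpow_neg hq.le]
        calc _ = (p ^ r * p ^ (-(g+r+1/2))) * (q ^ (2*(g+r)+1) * q ^ (-(g+r+1/2)) * q ^ (-r)) := by ring
          _ = _ := by
            rw [← Real.rpow_add hp, ← Real.rpow_add hq, ← Real.rpow_add hq]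
            congr 2 <;> ring
      have a1 := aux _ _ α x hs hs'
      have a2 := aux _ _ β y hc hc'
      rw [mul_inv]
      calc _ = C * d ^ (σ-1) * f φ *
            (Real.sin (θ/2) ^ x * Real.sin (φ/2) ^ (2*(α+x)+1) *
              (Real.sin (θ/2) * Real.sin (φ/2)) ^ (-(α+x+1/2)) * (Real.sin (φ/2) ^ x)⁻¹) *
            (Real.cos (θ/2) ^ y * Real.cos (φ/2) ^ (2*(β+y)+1) *
              (Real.cos (θ/2) * Real.cos (φ/2)) ^ (-(β+y+1/2)) * (Real.cos (φ/2) ^ y)⁻¹) := by ring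
        _ = _ := by rw [a1, a2]; ring
end
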